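/- Let n_1, n_2, n_3 be positive integers with n = n_1 + n_2 + n_3, and let γ ∈ B_n be an element with exactly 3 orbits, all inversion-invariant, of sizes 2n_1, 2n_2, 2n_3. Then |NC^B(n_1,n_2,n_3)| = (1 + n_1n_2/(n_1+n_2) + n_1n_3/(n_1+n_3) + n_2n_3/(n_2+n_3)) · C(2n_1, n_1) · C(2n_2, n_2) · C(2n_3, n_3). -/

import Mathlib

/-!  Common setup: annular non-crossing partitions of type B, following
Goulden–Nica–Oancea, "Enumerative properties of NC^(B)(p,q)". -/

/-- The underlying set `{±1, …, ±n}`, realized inside `ℤ`. -/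
def signedSet (n : ℕ) : Set ℤ := {x : ℤ | x ≠ 0 ∧ |x| ≤ (n : ℤ)}

/-- Membership in the hyperoctahedral group `B_n`, realized as the permutations of `ℤ`
that commute with negation and fix every point outside `{±1, …, ±n}`. -/
def inB (n : ℕ) (π : Equiv.Perm ℤ) : Prop :=
  (∀ x : ℤ, π (-x) = -(π x)) ∧ ∀ x : ℤ, x ∉ signedSet n → π x = x

/-- The set of generators of `B_n`:
`(i,j)(-i,-j)`, `(i,-j)(-i,j)` for `1 ≤ i ≠ j ≤ n`, and `(i,-i)` for `1 ≤ i ≤ n`. -/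
def genB (n : ℕ) : Set (Equiv.Perm ℤ) :=
  {π | (∃ i j : ℤ, 1 ≤ i ∧ i ≤ (n : ℤ) ∧ 1 ≤ j ∧ j ≤ (n : ℤ) ∧ i ≠ j ∧
          π = Equiv.swap i j * Equiv.swap (-i) (-j)) ∨
       (∃ i j : ℤ, 1 ≤ i ∧ i ≤ (n : ℤ) ∧ 1 ≤ j ∧ j ≤ (n : ℤ) ∧ i ≠ j ∧
          π = Equiv.swap i (-j) * Equiv.swap (-i) j) ∨
       (∃ i : ℤ, 1 ≤ i ∧ i ≤ (n : ℤ) ∧ π = Equiv.swap i (-i))}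

/-- The length function `ℓ_B` on `B_n`: the least `k` such that `τ` is a product of `k`
generators from `genB n` (the empty product being the identity). -/
noncomputable def lenB (n : ℕ) (τ : Equiv.Perm ℤ) : ℕ :=
  sInf {k : ℕ | ∃ l : List (Equiv.Perm ℤ),
    l.length = k ∧ (∀ g ∈ l, g ∈ genB n) ∧ l.prod = τ}

/-- The partial order on `B_n`:  `τ ≤ σ` iff `ℓ_B(σ) = ℓ_B(τ) + ℓ_B(τ⁻¹σ)`. -/
def leB (n : ℕ) (τ σ : Equiv.Perm ℤ) : Prop :=
  lenB n σ = lenB n τ + lenB n (τ⁻¹ * σ)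

/-- The permutation `γ_{p,q} = (1,…,p,-1,…,-p)(p+1,…,p+q,-(p+1),…,-(p+q))`. -/
def gammaPQ (p q : ℕ) : Equiv.Perm ℤ :=
  (((List.range p).map fun i => ((i : ℤ) + 1)) ++
      ((List.range p).map fun i => -((i : ℤ) + 1))).formPerm *
    (((List.range q).map fun i => ((p : ℤ) + (i : ℤ) + 1)) ++
      ((List.range q).map fun i => -((p : ℤ) + (i : ℤ) + 1))).formPerm

/-- The long cycle `γ_n = (1,…,n,-1,…,-n)` of `B_n` (disc case). -/
def gammaDisc (n : ℕ) : Equiv.Perm ℤ :=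
  (((List.range n).map fun i => ((i : ℤ) + 1)) ++
    ((List.range n).map fun i => -((i : ℤ) + 1))).formPerm

/-- The annular non-crossing permutations of type B: `S^B_nc(p,q) = [ε, γ_{p,q}] ⊆ B_{p+q}`. -/
def SncB (p q : ℕ) : Set (Equiv.Perm ℤ) :=
  {τ | inB (p + q) τ ∧ leB (p + q) τ (gammaPQ p q)}

/-- The orbit of `x` under the permutation `τ`. -/
def permOrbit (τ : Equiv.Perm ℤ) (x : ℤ) : Set ℤ := {y | ∃ m : ℤ, (τ ^ m) x = y}

/-- The partition `Ω(τ)` of `{±1,…,±n}` into orbits of `τ`. -/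
def orbitsOn (n : ℕ) (τ : Equiv.Perm ℤ) : Set (Set ℤ) :=
  {A | ∃ x ∈ signedSet n, A = permOrbit τ x}

/-- The negation `-A` of a set `A ⊆ ℤ`. -/
def negSet (A : Set ℤ) : Set ℤ := {x | -x ∈ A}

/-- The partition `Ω̃(τ)`, obtained from `Ω(τ)` by merging all inversion-invariant orbits
(orbits `A` with `A = -A`) into a single block. -/
def omegaTilde (n : ℕ) (τ : Equiv.Perm ℤ) : Set (Set ℤ) :=
  {A | A ∈ orbitsOn n τ ∧ negSet A ≠ A} ∪
    {B | B = ⋃₀ {A | A ∈ orbitsOn n τ ∧ negSet A = A} ∧ B.Nonempty}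

/-- The annular non-crossing partitions of type B: `NC^B(p,q) = {Ω̃(τ) : τ ∈ S^B_nc(p,q)}`. -/
def NCB (p q : ℕ) : Set (Set (Set ℤ)) :=
  {π | ∃ τ ∈ SncB p q, π = omegaTilde (p + q) τ}

/-- The type B non-crossing partitions of the disc: `NC^B(n) = {Ω̃(τ) : τ ∈ B_n, τ ≤ γ_n}`. -/
def NCBdisc (n : ℕ) : Set (Set (Set ℤ)) :=
  {π | ∃ τ, inB n τ ∧ leB n τ (gammaDisc n) ∧ π = omegaTilde n τ}

/-- Reverse refinement order on partitions: every block of `π` is contained in a block of `ρ`. -/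
def refines (π ρ : Set (Set ℤ)) : Prop := ∀ A ∈ π, ∃ B ∈ ρ, A ⊆ B

/-- The rank of a partition of `{±1,…,±n}`:
`n` minus half the number of blocks `A` with `A ≠ -A`. -/
noncomputable def rankNCB (n : ℕ) (π : Set (Set ℤ)) : ℕ :=
  n - {A | A ∈ π ∧ negSet A ≠ A}.ncard / 2

/-- The inner point set `{±(p+1), …, ±(p+q)}`. -/
def innerSet (p q : ℕ) : Set ℤ := {x : ℤ | (p : ℤ) < |x| ∧ |x| ≤ (p : ℤ) + (q : ℤ)}

/-- The connectivity of `π ∈ NC^B(p,q)`: half the number of blocks `A` with `A ≠ -A`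
meeting both `{±1,…,±p}` and `{±(p+1),…,±(p+q)}`. -/
noncomputable def connectivity (p q : ℕ) (π : Set (Set ℤ)) : ℕ :=
  {A | A ∈ π ∧ negSet A ≠ A ∧ (A ∩ signedSet p).Nonempty ∧
    (A ∩ innerSet p q).Nonempty}.ncard / 2

/-- The number of exterior pairs of blocks `{A, -A}` (with `A ≠ -A`, `A ⊆ {±1,…,±p}`). -/
noncomputable def extPairs (p : ℕ) (π : Set (Set ℤ)) : ℕ :=
  {A | A ∈ π ∧ negSet A ≠ A ∧ A ⊆ signedSet p}.ncard / 2

/-- The number of interior pairs of blocks `{A, -A}`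
(with `A ≠ -A`, `A ⊆ {±(p+1),…,±(p+q)}`). -/
noncomputable def intPairs (p q : ℕ) (π : Set (Set ℤ)) : ℕ :=
  {A | A ∈ π ∧ negSet A ≠ A ∧ A ⊆ innerSet p q}.ncard / 2

/-- The minimum `0̂` of `NC^B(p,q)` (with `n = p+q`): the partition into singletons. -/
def botNCB (n : ℕ) : Set (Set ℤ) := {A | ∃ x ∈ signedSet n, A = {x}}

/-- The maximum `1̂` of `NC^B(p,q)` (with `n = p+q`): the partition with a single block. -/
def topNCB (n : ℕ) : Set (Set ℤ) := {signedSet n}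

/-- The orbit of `x` under the subgroup generated by `{τ, γ}`. -/
def jointOrbit (τ γ : Equiv.Perm ℤ) (x : ℤ) : Set ℤ :=
  {y | ∃ g ∈ Subgroup.closure ({τ, γ} : Set (Equiv.Perm ℤ)), g x = y}

/-- The orbits on `{±1,…,±n}` of the subgroup generated by `{τ, γ}`. -/
def jointOrbitsOn (n : ℕ) (τ γ : Equiv.Perm ℤ) : Set (Set ℤ) :=
  {Y | ∃ x ∈ signedSet n, Y = jointOrbit τ γ x}

namespace NCBaux

/-- odd functions supported on the signed set -/
def VV (n : ℕ) : Submodule ℚ (ℤ → ℚ) where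
  carrier := {f | (∀ x, f (-x) = - f x) ∧ ∀ x, x ∉ signedSet n → f x = 0}
  add_mem' := by
    rintro f g ⟨h1, h2⟩ ⟨h3, h4⟩
    refine ⟨fun x => ?_, fun x hx => ?_⟩
    · simp [h1, h3]; ring
    · simp [h2 x hx, h4 x hx]
  zero_mem' := by simp
  smul_mem' := by
    rintro c f ⟨h1, h2⟩
    refine ⟨fun x => ?_, fun x hx => ?_⟩
    · simp [h1]
    · simp [h2 x hx]

/-- fixed functions -/
def Fx (n : ℕ) (τ : Equiv.Perm ℤ) : Submodule ℚ (ℤ → ℚ) where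
  carrier := {f | f ∈ VV n ∧ ∀ x, f (τ x) = f x}
  add_mem' := by
    rintro f g ⟨h1, h2⟩ ⟨h3, h4⟩
    exact ⟨add_mem h1 h3, fun x => by simp [h2, h4]⟩
  zero_mem' := ⟨zero_mem _, by simp⟩
  smul_mem' := by
    rintro c f ⟨h1, h2⟩
    exact ⟨Submodule.smul_mem _ _ h1, fun x => by simp [h2]⟩

lemma mem_VV {n : ℕ} {f : ℤ → ℚ} :
    f ∈ VV n ↔ (∀ x, f (-x) = - f x) ∧ ∀ x, x ∉ signedSet n → f x = 0 := Iff.rfl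

lemma mem_Fx {n : ℕ} {τ : Equiv.Perm ℤ} {f : ℤ → ℚ} :
    f ∈ Fx n τ ↔ f ∈ VV n ∧ ∀ x, f (τ x) = f x := Iff.rfl

lemma Fx_le (n : ℕ) (τ : Equiv.Perm ℤ) : Fx n τ ≤ VV n := fun _ h => h.1

lemma signed_finite (n : ℕ) : (signedSet n).Finite := by
  apply (Set.finite_Icc (-(n:ℤ)) n).subset
  rintro x ⟨_, h⟩
  exact abs_le.mp h

lemma neg_signed {n : ℕ} {x : ℤ} : -x ∈ signedSet n ↔ x ∈ signedSet n := by
  simp [signedSet]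

instance finVV (n : ℕ) : FiniteDimensional ℚ (VV n) := by
  have : Finite (signedSet n) := (signed_finite n).to_subtype
  let φ : VV n →ₗ[ℚ] (signedSet n → ℚ) :=
    { toFun := fun f x => f.1 x.1
      map_add' := by intros; rfl
      map_smul' := by intros; rfl }
  apply FiniteDimensional.of_injective φ
  intro f g h
  ext x
  by_cases hx : x ∈ signedSet n
  · exact congrFun h ⟨x, hx⟩
  · rw [f.2.2 x hx, g.2.2 x hx]

instance finFx (n : ℕ) (τ : Equiv.Perm ℤ) : FiniteDimensional ℚ (Fx n τ) :=
  Submodule.finiteDimensional_of_le (Fx_le n τ)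

/-- dimension of the fixed space -/
noncomputable def dd (n : ℕ) (τ : Equiv.Perm ℤ) : ℕ := Module.finrank ℚ (Fx n τ)
noncomputable def NN (n : ℕ) : ℕ := Module.finrank ℚ (VV n)
/-- codimension -/
noncomputable def rr (n : ℕ) (τ : Equiv.Perm ℤ) : ℕ := NN n - dd n τ

lemma rr_add (n : ℕ) (τ : Equiv.Perm ℤ) : rr n τ + dd n τ = NN n :=
  Nat.sub_add_cancel (Submodule.finrank_mono (Fx_le n τ))

lemma inB_one (n : ℕ) : inB n 1 := ⟨by simp, by simp⟩

lemma inB_mul {n : ℕ} {a b : Equiv.Perm ℤ} (ha : inB n a) (hb : inB n b) : inB n (a * b) :=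
  ⟨fun x => by simp [hb.1, ha.1], fun x hx => by simp [hb.2 x hx, ha.2 x hx]⟩

lemma inB_inv {n : ℕ} {a : Equiv.Perm ℤ} (ha : inB n a) : inB n a⁻¹ := by
  refine ⟨fun x => ?_, fun x hx => ?_⟩
  · rw [Equiv.Perm.inv_eq_iff_eq, ha.1]; simp
  · rw [Equiv.Perm.inv_eq_iff_eq, ha.2 x hx]

lemma inB_mem {n : ℕ} {a : Equiv.Perm ℤ} (ha : inB n a) {x : ℤ} :
    a x ∈ signedSet n ↔ x ∈ signedSet n := by
  constructor
  · intro h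
    by_contra hx
    rw [ha.2 x hx] at h; exact hx h
  · intro h
    by_contra hx
    have := ha.2 _ hx
    rw [a.injective this] at hx
    exact hx h

lemma inB_finite (n : ℕ) : {τ : Equiv.Perm ℤ | inB n τ}.Finite := by
  have : Finite (signedSet n) := (signed_finite n).to_subtype
  classical
  have e := Equiv.Perm.subtypeEquivSubtypePerm (fun x => x ∈ signedSet n)
  have : Finite {f : Equiv.Perm ℤ // ∀ a, ¬ a ∈ signedSet n → f a = a} := Finite.of_equiv _ e
  have h2 : {f : Equiv.Perm ℤ | ∀ a, ¬ a ∈ signedSet n → f a = a}.Finite := Set.finite_coe_iff.1 this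
  exact h2.subset fun τ h => h.2

lemma Fx_inv (n : ℕ) (τ : Equiv.Perm ℤ) : Fx n τ⁻¹ = Fx n τ := by
  ext f
  simp only [mem_Fx]
  refine and_congr_right fun _ => ⟨fun h x => ?_, fun h x => ?_⟩
  · have := h (τ x); simpa using this.symm
  · have := h (τ⁻¹ x); simpa using this.symm

lemma rr_inv (n : ℕ) (τ : Equiv.Perm ℤ) : rr n τ⁻¹ = rr n τ := by
  unfold rr dd; rw [Fx_inv]

lemma Fx_inf_le (n : ℕ) (a b : Equiv.Perm ℤ) : Fx n a ⊓ Fx n b ≤ Fx n (a * b) := by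
  rintro f ⟨h1, h2⟩
  exact ⟨h1.1, fun x => by simp [h1.2, h2.2]⟩

lemma dim_ineq (n : ℕ) (a b : Equiv.Perm ℤ) :
    dd n a + dd n b ≤ NN n + Module.finrank ℚ ↥(Fx n a ⊓ Fx n b) := by
  have := Submodule.finrank_sup_add_finrank_inf_eq (Fx n a) (Fx n b)
  have h2 : Module.finrank ℚ ↥(Fx n a ⊔ Fx n b) ≤ NN n :=
    Submodule.finrank_mono (sup_le (Fx_le n a) (Fx_le n b))
  unfold dd
  omega

lemma rr_mul_le (n : ℕ) (a b : Equiv.Perm ℤ) : rr n (a * b) ≤ rr n a + rr n b := by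
  have h1 := dim_ineq n a b
  have h2 : Module.finrank ℚ ↥(Fx n a ⊓ Fx n b) ≤ dd n (a * b) :=
    Submodule.finrank_mono (Fx_inf_le n a b)
  have := rr_add n a
  have := rr_add n b
  have := rr_add n (a * b)
  omega

lemma rr_one (n : ℕ) : rr n 1 = 0 := by
  have : Fx n 1 = VV n := by
    ext f; simp [mem_Fx]
  unfold rr dd NN; rw [this]; simp

/-- additive factorizations have nice fixed spaces -/
lemma Fx_inf_eq {n : ℕ} {a b : Equiv.Perm ℤ} (h : rr n (a * b) = rr n a + rr n b) :
    Fx n a ⊓ Fx n b = Fx n (a * b) := by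
  apply Submodule.eq_of_le_of_finrank_le (Fx_inf_le n a b)
  have h1 := dim_ineq n a b
  have := rr_add n a
  have := rr_add n b
  have := rr_add n (a * b)
  change dd n (a * b) ≤ _
  omega

lemma Fx_sup_eq {n : ℕ} {a b : Equiv.Perm ℤ} (h : rr n (a * b) = rr n a + rr n b) :
    Fx n a ⊔ Fx n b = VV n := by
  apply Submodule.eq_of_le_of_finrank_le (sup_le (Fx_le n a) (Fx_le n b))
  have h1 := Submodule.finrank_sup_add_finrank_inf_eq (Fx n a) (Fx n b)
  rw [Fx_inf_eq h] at h1
  have := rr_add n a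
  have := rr_add n b
  have := rr_add n (a * b)
  change NN n ≤ _
  unfold dd at *
  omega

/-- the order via codimension -/
def le' (n : ℕ) (τ σ : Equiv.Perm ℤ) : Prop := rr n σ = rr n τ + rr n (τ⁻¹ * σ)

lemma le'_Fx {n : ℕ} {τ σ : Equiv.Perm ℤ} (h : le' n τ σ) : Fx n σ ≤ Fx n τ := by
  have : rr n (τ * (τ⁻¹ * σ)) = rr n τ + rr n (τ⁻¹ * σ) := by simpa [le'] using h
  have := Fx_inf_eq this
  simp only [mul_inv_cancel_left] at this
  rw [← this]; exact inf_le_left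

lemma le'_sup {n : ℕ} {τ σ : Equiv.Perm ℤ} (h : le' n τ σ) :
    Fx n τ ⊔ Fx n (τ⁻¹ * σ) = VV n := by
  have : rr n (τ * (τ⁻¹ * σ)) = rr n τ + rr n (τ⁻¹ * σ) := by simpa [le'] using h
  exact Fx_sup_eq this

lemma rr_le_aux (n : ℕ) (τ σ : Equiv.Perm ℤ) : rr n σ ≤ rr n τ + rr n (τ⁻¹ * σ) := by
  have := rr_mul_le n τ (τ⁻¹ * σ)
  simpa using this

/-- odd indicator of a list -/
noncomputable def eL (L : List ℤ) (w : ℤ) : ℚ :=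
  (if w ∈ L then 1 else 0) - (if -w ∈ L then 1 else 0)

lemma eL_mem {n : ℕ} {L : List ℤ} (h : ∀ z ∈ L, z ∈ signedSet n) : eL L ∈ VV n := by
  refine ⟨fun x => ?_, fun x hx => ?_⟩
  · simp [eL]
  · have h1 : x ∉ L := fun h' => hx (h x h')
    have h2 : -x ∉ L := fun h' => hx (neg_signed.1 (h _ h'))
    simp [eL, h1, h2]

lemma eL_Fx {n : ℕ} {β : Equiv.Perm ℤ} (hβ : inB n β) {L : List ℤ}
    (h : ∀ z ∈ L, z ∈ signedSet n) (h2 : ∀ w, β w ∈ L ↔ w ∈ L) : eL L ∈ Fx n β := by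
  refine ⟨eL_mem h, fun x => ?_⟩
  have h3 : -β x ∈ L ↔ -x ∈ L := by rw [← hβ.1, h2]
  simp only [eL, h2, h3]

/-- reflection swapping x and y (and negatives) -/
def T (x y : ℤ) : Equiv.Perm ℤ :=
  if y = x ∨ y = -x then Equiv.swap x y else Equiv.swap x y * Equiv.swap (-x) (-y)

lemma T_apply {x y : ℤ} (hx : x ≠ 0) (hy : y ≠ 0) (w : ℤ) :
    T x y w = if w = x then y else if w = -x then -y else if w = y then x
      else if w = -y then -x else w := by
  unfold T
  split_ifs with h <;> simp only [Equiv.Perm.mul_apply, Equiv.swap_apply_def] <;> grind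

lemma T_self {x : ℤ} : T x x = 1 := by simp [T]; rfl

lemma T_invol {x y : ℤ} (hx : x ≠ 0) (hy : y ≠ 0) : T x y * T x y = 1 := by
  ext w
  simp only [Equiv.Perm.mul_apply, T_apply hx hy, Equiv.Perm.one_apply]
  grind

lemma T_inv {x y : ℤ} (hx : x ≠ 0) (hy : y ≠ 0) : (T x y)⁻¹ = T x y :=
  inv_eq_of_mul_eq_one_left (T_invol hx hy)

lemma T_comm {x y : ℤ} (hx : x ≠ 0) (hy : y ≠ 0) : T x y = T y x := by
  ext w
  simp only [T_apply hx hy, T_apply hy hx]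
  grind

lemma T_neg {x y : ℤ} (hx : x ≠ 0) (hy : y ≠ 0) : T (-x) (-y) = T x y := by
  ext w
  have hx' : -x ≠ 0 := by simpa
  have hy' : -y ≠ 0 := by simpa
  simp only [T_apply hx hy, T_apply hx' hy']
  grind

lemma T_inB {n : ℕ} {x y : ℤ} (hx : x ∈ signedSet n) (hy : y ∈ signedSet n) : inB n (T x y) := by
  refine ⟨fun w => ?_, fun w hw => ?_⟩
  · simp only [T_apply hx.1 hy.1]
    have := hx.1
    have := hy.1
    grind
  · have h1 : w ≠ x := by rintro rfl; exact hw hx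
    have h2 : w ≠ y := by rintro rfl; exact hw hy
    have h3 : w ≠ -x := by rintro rfl; exact hw (neg_signed.2 hx)
    have h4 : w ≠ -y := by rintro rfl; exact hw (neg_signed.2 hy)
    simp [T_apply hx.1 hy.1, h1, h2, h3, h4]

lemma T_left {x y : ℤ} (hx : x ≠ 0) (hy : y ≠ 0) : T x y x = y := by
  rw [T_apply hx hy]; simp

lemma T_right {x y : ℤ} (hx : x ≠ 0) (hy : y ≠ 0) : T x y y = x := by
  rw [T_comm hx hy, T_left hy hx]

lemma T_conj {n : ℕ} {g : Equiv.Perm ℤ} (hg : inB n g) {x y : ℤ} (hx : x ∈ signedSet n)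
    (hy : y ∈ signedSet n) : g * T x y = T (g x) (g y) * g := by
  ext w
  have h1 := ((inB_mem hg).2 hx).1
  have h2 := ((inB_mem hg).2 hy).1
  simp only [Equiv.Perm.mul_apply, T_apply hx.1 hy.1, T_apply h1 h2, ← hg.1,
    EmbeddingLike.apply_eq_iff_eq]
  split_ifs <;> rfl

lemma mem_FxT {n : ℕ} {x y : ℤ} (hx : x ∈ signedSet n) (hy : y ∈ signedSet n) {f : ℤ → ℚ} :
    f ∈ Fx n (T x y) ↔ f ∈ VV n ∧ f x = f y := by
  rw [mem_Fx]
  refine and_congr_right fun hf => ⟨fun h => ?_, fun h w => ?_⟩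
  · have := h x
    rw [T_left hx.1 hy.1] at this; exact this.symm
  · rw [T_apply hx.1 hy.1]
    have := hf.1 x
    have := hf.1 y
    split_ifs <;> simp_all

lemma rr_T_le {n : ℕ} {x y : ℤ} (hx : x ∈ signedSet n) (hy : y ∈ signedSet n) :
    rr n (T x y) ≤ 1 := by
  let φ : VV n →ₗ[ℚ] ℚ :=
    { toFun := fun f => f.1 x - f.1 y
      map_add' := by intro f g; simp; ring
      map_smul' := by intro c f; simp; ring }
  have h1 := LinearMap.finrank_range_add_finrank_ker φ
  have h2 : Module.finrank ℚ (LinearMap.range φ) ≤ 1 := by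
    have := Submodule.finrank_le (LinearMap.range φ)
    simpa using this
  have h3 : (LinearMap.ker φ).map (VV n).subtype ≤ Fx n (T x y) := by
    rintro f ⟨g, hg, rfl⟩
    rw [mem_FxT hx hy]
    refine ⟨g.2, ?_⟩
    have : g.1 x - g.1 y = 0 := hg
    simpa using sub_eq_zero.1 this
  have h4 := Submodule.finrank_mono h3
  rw [LinearEquiv.finrank_eq (Submodule.equivMapOfInjective _ (Submodule.injective_subtype _) _).symm] at h4
  have := rr_add n (T x y)
  unfold dd NN at *
  omega

lemma rr_lt_of {n : ℕ} {x y : ℤ} (hx : x ∈ signedSet n) (hy : y ∈ signedSet n)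
    {τ : Equiv.Perm ℤ} (h : Fx n τ ≤ Fx n (T x y)) {f : ℤ → ℚ} (hf : f ∈ Fx n (T x y * τ))
    (hf2 : f ∉ Fx n τ) : rr n (T x y * τ) + 1 = rr n τ := by
  have h1 : Fx n τ < Fx n (T x y * τ) := by
    refine lt_of_le_of_ne (le_trans (le_inf h le_rfl) (Fx_inf_le _ _ _)) ?_
    rintro h; exact hf2 (h ▸ hf)
  have h2 : dd n τ < dd n (T x y * τ) := Submodule.finrank_lt_finrank_of_lt h1
  have h3 := rr_mul_le n (T x y) (T x y * τ)
  rw [← mul_assoc, T_invol hx.1 hy.1, one_mul] at h3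
  have := rr_T_le hx hy
  have := rr_add n τ
  have := rr_add n (T x y * τ)
  omega

lemma rr_grow {n : ℕ} {τ : Equiv.Perm ℤ} (hτ : inB n τ) {x : ℤ} (hx : x ∈ signedSet n)
    (h : τ x ≠ x) : rr n (T x (τ x) * τ) + 1 = rr n τ := by
  have hy : τ x ∈ signedSet n := (inB_mem hτ).2 hx
  have hfx : (T x (τ x) * τ) x = x := by simp [T_right hx.1 hy.1]
  apply rr_lt_of hx hy (f := eL [x])
  · intro f hf
    rw [mem_FxT hx hy]
    exact ⟨hf.1, (hf.2 x).symm⟩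
  · apply eL_Fx (inB_mul (T_inB hx hy) hτ) (by simpa using hx)
    intro w
    simp only [List.mem_singleton]
    constructor
    · intro h'; exact Equiv.injective _ (h'.trans hfx.symm)
    · rintro rfl; exact hfx
  · rintro ⟨_, h2⟩
    have := h2 x
    have hx0 := hx.1
    have h3 : -x ≠ x := by intro; apply hx0; omega
    simp only [eL, List.mem_singleton, h, h3] at this
    split_ifs at this <;> norm_num at *

lemma rr_grow_right {n : ℕ} {τ : Equiv.Perm ℤ} (hτ : inB n τ) {x : ℤ} (hx : x ∈ signedSet n)
    (h : τ⁻¹ x ≠ x) : rr n (τ * T x (τ⁻¹ x)) + 1 = rr n τ := by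
  have := rr_grow (inB_inv hτ) hx h
  rw [rr_inv] at this
  rw [← this, ← rr_inv, mul_inv_rev, T_inv hx.1 ((inB_mem (inB_inv hτ)).2 hx).1]

lemma T_gen {n : ℕ} {x y : ℤ} (hx : x ∈ signedSet n) (hy : y ∈ signedSet n) (hxy : x ≠ y) :
    T x y ∈ genB n := by
  have key : ∀ x y : ℤ, x ∈ signedSet n → y ∈ signedSet n → x ≠ y → 0 < x → T x y ∈ genB n := by
    rintro x y ⟨hx, hx'⟩ ⟨hy, hy'⟩ hxy h0
    rw [abs_le] at hx' hy'
    by_cases h : y = -x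
    · right; right
      exact ⟨x, by omega, by omega, by simp [T, h]⟩
    · have hT : T x y = Equiv.swap x y * Equiv.swap (-x) (-y) := by
        rw [T, if_neg]; rintro (h' | h')
        · exact hxy h'.symm
        · exact h h'
      rcases lt_or_gt_of_ne hy with h1 | h1
      · right; left
        exact ⟨x, -y, by omega, by omega, by omega, by omega, by omega, by rw [hT]; simp⟩
      · left
        exact ⟨x, y, by omega, by omega, by omega, by omega, by omega, hT⟩
  rcases lt_or_gt_of_ne hx.1 with h | h
  · rw [← T_neg hx.1 hy.1]
    exact key _ _ (neg_signed.2 hx) (neg_signed.2 hy) (by simpa using hxy) (by omega)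
  · exact key x y hx hy hxy h

lemma gen_T {n : ℕ} {g : Equiv.Perm ℤ} (hg : g ∈ genB n) :
    ∃ x y, x ∈ signedSet n ∧ y ∈ signedSet n ∧ g = T x y := by
  have hs : ∀ i : ℤ, 1 ≤ i → i ≤ n → i ∈ signedSet n := fun i h1 h2 =>
    ⟨by omega, by rw [abs_le]; omega⟩
  rcases hg with ⟨i, j, h1, h2, h3, h4, h5, rfl⟩ | ⟨i, j, h1, h2, h3, h4, h5, rfl⟩ | ⟨i, h1, h2, rfl⟩
  · refine ⟨i, j, hs i h1 h2, hs j h3 h4, ?_⟩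
    rw [T, if_neg (by omega)]
  · refine ⟨i, -j, hs i h1 h2, neg_signed.2 (hs j h3 h4), ?_⟩
    rw [T, if_neg (by omega)]; simp
  · refine ⟨i, -i, hs i h1 h2, neg_signed.2 (hs i h1 h2), ?_⟩
    simp [T]

lemma exists_word {n : ℕ} : ∀ (k : ℕ) (τ : Equiv.Perm ℤ), inB n τ → rr n τ = k →
    ∃ l : List (Equiv.Perm ℤ), l.length ≤ k ∧ (∀ g ∈ l, g ∈ genB n) ∧ l.prod = τ := by
  intro k
  induction k with
  | zero =>
    intro τ hτ h
    refine ⟨[], by simp, by simp, ?_⟩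
    by_contra hne
    have : ∃ x, τ x ≠ x := by
      by_contra! hh
      exact hne (Equiv.ext (fun x => by simp [hh])) 
    obtain ⟨x, hx⟩ := this
    have hxs : x ∈ signedSet n := by
      by_contra h'; exact hx (hτ.2 x h')
    have := rr_grow hτ hxs hx
    omega
  | succ k ih =>
    intro τ hτ h
    have : ∃ x, τ x ≠ x := by
      by_contra! hh
      have : τ = 1 := Equiv.ext (fun x => by simp [hh])
      rw [this, rr_one] at h; omega
    obtain ⟨x, hx⟩ := this
    have hxs : x ∈ signedSet n := by
      by_contra h'; exact hx (hτ.2 x h')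
    have h2 := rr_grow hτ hxs hx
    have hy := (inB_mem hτ).2 hxs
    obtain ⟨l, hl1, hl2, hl3⟩ := ih (T x (τ x) * τ) (inB_mul (T_inB hxs hy) hτ) (by omega)
    refine ⟨T x (τ x) :: l, by simpa using hl1, ?_, ?_⟩
    · intro g hg
      rcases List.mem_cons.1 hg with rfl | hg
      · exact T_gen hxs hy hx.symm
      · exact hl2 g hg
    · rw [List.prod_cons, hl3, ← mul_assoc, T_invol hxs.1 hy.1, one_mul]

lemma rr_word {n : ℕ} (l : List (Equiv.Perm ℤ)) (h : ∀ g ∈ l, g ∈ genB n) :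
    rr n l.prod ≤ l.length := by
  induction l with
  | nil => simp [rr_one]
  | cons g l ih =>
    rw [List.prod_cons, List.length_cons]
    have h1 := rr_mul_le n g l.prod
    have h2 := ih fun g hg => h g (List.mem_cons_of_mem _ hg)
    obtain ⟨x, y, hx, hy, rfl⟩ := gen_T (h g List.mem_cons_self)
    have := rr_T_le hx hy
    omega

lemma lenB_eq {n : ℕ} {τ : Equiv.Perm ℤ} (hτ : inB n τ) : lenB n τ = rr n τ := by
  obtain ⟨l, h1, h2, h3⟩ := exists_word _ τ hτ rfl
  apply le_antisymm
  · exact le_trans (Nat.sInf_le (show l.length ∈ _ from ⟨l, rfl, h2, h3⟩)) h1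
  · have hne : {k : ℕ | ∃ l : List (Equiv.Perm ℤ),
      l.length = k ∧ (∀ g ∈ l, g ∈ genB n) ∧ l.prod = τ}.Nonempty := ⟨_, l, rfl, h2, h3⟩
    obtain ⟨l', h4, h5, h6⟩ := Nat.sInf_mem hne
    unfold lenB
    rw [← h4, ← h6]
    exact rr_word l' h5

lemma leB_iff {n : ℕ} {τ σ : Equiv.Perm ℤ} (hτ : inB n τ) (hσ : inB n σ) :
    leB n τ σ ↔ le' n τ σ := by
  rw [leB, le', lenB_eq hτ, lenB_eq hσ, lenB_eq (inB_mul (inB_inv hτ) hσ)]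

def Sset (n : ℕ) (γ : Equiv.Perm ℤ) : Set (Equiv.Perm ℤ) := {τ | inB n τ ∧ le' n τ γ}

noncomputable def Nc (n : ℕ) (γ : Equiv.Perm ℤ) : ℕ := (Sset n γ).ncard

noncomputable def Gc (n : ℕ) (γ : Equiv.Perm ℤ) (x y : ℤ) : ℕ :=
  {τ | τ ∈ Sset n γ ∧ τ x = y}.ncard

lemma Sset_finite (n : ℕ) (γ : Equiv.Perm ℤ) : (Sset n γ).Finite :=
  (inB_finite n).subset fun _ h => h.1

lemma step_le {n : ℕ} {γ τ : Equiv.Perm ℤ} (hτ : inB n τ) {x y : ℤ}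
    (hx : x ∈ signedSet n) (hy : y ∈ signedSet n) (hxy : y ≠ x)
    (h : rr n (T x y * γ) + 1 = rr n γ) :
    (le' n τ γ ∧ τ x = y) ↔ (le' n (T x y * τ) (T x y * γ) ∧ (T x y * τ) x = x) := by
  have e : (T x y * τ)⁻¹ * (T x y * γ) = τ⁻¹ * γ := by group
  unfold le'
  rw [e]
  constructor
  · rintro ⟨h1, h2⟩
    have := rr_grow hτ hx (h2 ▸ hxy)
    rw [h2] at this
    refine ⟨by omega, ?_⟩
    simp [h2, T_right hx.1 hy.1]
  · rintro ⟨h1, h2⟩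
    have h3 : τ x = y := by
      have := congrArg (T x y) h2
      rw [← Equiv.Perm.mul_apply, ← mul_assoc, T_invol hx.1 hy.1, T_left hx.1 hy.1] at this
      simpa using this
    refine ⟨?_, h3⟩
    have := rr_grow hτ hx (h3 ▸ hxy)
    rw [h3] at this
    omega

lemma rem_le {n : ℕ} {β τ : Equiv.Perm ℤ} (hβ : inB n β) (hτ : inB n τ) {x : ℤ}
    (hx : x ∈ signedSet n) :
    (le' n τ β ∧ τ x = x) ↔ le' n τ (T x (β x) * β) := by
  by_cases hfx : β x = x
  · rw [hfx, T_self, one_mul]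
    constructor
    · exact fun h => h.1
    · intro h
      refine ⟨h, ?_⟩
      by_contra hne
      have h1 : eL [x] ∈ Fx n β := by
        apply eL_Fx hβ (by simpa using hx)
        intro w
        simp only [List.mem_singleton]
        constructor
        · intro h'; exact Equiv.injective _ (h'.trans hfx.symm)
        · rintro rfl; exact hfx
      have := (le'_Fx h h1).2 x
      have hx0 := hx.1
      have h3 : -x ≠ x := by intro; apply hx0; omega
      simp only [eL, List.mem_singleton, hne, h3] at this
      split_ifs at this <;> norm_num at *
  · have hb : β x ∈ signedSet n := (inB_mem hβ).2 hx
    have hu : β⁻¹ x ∈ signedSet n := (inB_mem (inB_inv hβ)).2 hx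
    have hβ' : inB n (T x (β x) * β) := inB_mul (T_inB hx hb) hβ
    have g1 := rr_grow hβ hx hfx
    have e1 : T x (β x) * β = β * T x (β⁻¹ x) := by
      rw [T_conj hβ hx hu, T_comm ((inB_mem hβ).2 hx).1 ((inB_mem hβ).2 hu).1]
      simp
    have key : τ x = x → rr n (τ⁻¹ * (T x (β x) * β)) + 1 = rr n (τ⁻¹ * β) := by
      intro h2
      have h3 : (τ⁻¹ * β)⁻¹ x = β⁻¹ x := by simp [h2]
      have := rr_grow_right (inB_mul (inB_inv hτ) hβ) hx (by
        rw [h3]; intro h4; apply hfx; rw [Equiv.Perm.inv_eq_iff_eq] at h4; exact h4.symm)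
      rw [h3] at this
      rw [e1, ← mul_assoc]; exact this
    constructor
    · rintro ⟨h1, h2⟩
      have := key h2
      unfold le' at *
      omega
    · intro h
      have h2 : τ x = x := by
        by_contra hne
        have hf : (T x (β x) * β) x = x := by simp [T_right hx.1 hb.1]
        have h1 : eL [x] ∈ Fx n (T x (β x) * β) := by
          apply eL_Fx hβ' (by simpa using hx)
          intro w
          simp only [List.mem_singleton]
          constructor
          · intro h'; exact Equiv.injective _ (h'.trans hf.symm)
          · rintro rfl; exact hf
        have := (le'_Fx h h1).2 x
        have hx0 := hx.1
        have h3 : -x ≠ x := by intro; apply hx0; omega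
        simp only [eL, List.mem_singleton, hne, h3] at this
        split_ifs at this <;> norm_num at *
      have := key h2
      refine ⟨?_, h2⟩
      unfold le' at *
      omega

lemma Gc_eq {n : ℕ} {γ : Equiv.Perm ℤ} (hγ : inB n γ) {x y : ℤ}
    (hx : x ∈ signedSet n) (hy : y ∈ signedSet n)
    (h : y = x ∨ rr n (T x y * γ) + 1 = rr n γ) :
    Gc n γ x y = Nc n (T x ((T x y * γ) x) * (T x y * γ)) := by
  have hβ : inB n (T x y * γ) := inB_mul (T_inB hx hy) hγ
  have e : {τ | τ ∈ Sset n γ ∧ τ x = y} =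
      (fun τ => T x y * τ) '' Sset n (T x ((T x y * γ) x) * (T x y * γ)) := by
    have key : ∀ τ, inB n τ → ((le' n τ γ ∧ τ x = y) ↔
        le' n (T x y * τ) (T x ((T x y * γ) x) * (T x y * γ))) := by
      intro τ hτ
      rw [← rem_le hβ (inB_mul (T_inB hx hy) hτ) hx]
      by_cases hxy : y = x
      · subst hxy; rw [T_self]; simp
      · exact step_le hτ hx hy hxy (h.resolve_left hxy)
    have tt : ∀ τ, T x y * (T x y * τ) = τ := fun τ => by
      rw [← mul_assoc, T_invol hx.1 hy.1, one_mul]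
    ext τ
    constructor
    · rintro ⟨⟨h1, h2⟩, h3⟩
      exact ⟨T x y * τ, ⟨inB_mul (T_inB hx hy) h1, (key τ h1).1 ⟨h2, h3⟩⟩, tt τ⟩
    · rintro ⟨σ, ⟨h1, h2⟩, rfl⟩
      have h3 := inB_mul (T_inB hx hy) h1
      have := (key (T x y * σ) h3).2 (by rw [tt]; exact h2)
      exact ⟨⟨h3, this.1⟩, this.2⟩
  unfold Gc Nc
  rw [e, Set.ncard_image_of_injective _ (mul_right_injective _)]

lemma Gc_zero {n : ℕ} {γ : Equiv.Perm ℤ} {x y : ℤ}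
    {f : ℤ → ℚ} (hf : f ∈ Fx n γ) (hne : f x ≠ f y) : Gc n γ x y = 0 := by
  unfold Gc
  rw [Set.ncard_eq_zero ((Sset_finite n γ).subset fun _ h => h.1)]
  ext τ
  simp only [Set.mem_ofPred_eq, Set.mem_empty_iff_false, iff_false]
  rintro ⟨⟨h1, h2⟩, rfl⟩
  exact hne ((le'_Fx h2 hf).2 x).symm

lemma Nc_sum {n : ℕ} {γ : Equiv.Perm ℤ} {x : ℤ} (hx : x ∈ signedSet n) (U : Finset ℤ)
    (hU : ∀ y ∈ signedSet n, y ∉ U → Gc n γ x y = 0) :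
    Nc n γ = ∑ y ∈ U, Gc n γ x y := by
  classical
  have h1 : Nc n γ = (Sset_finite n γ).toFinset.card := by
    rw [Nc, Set.ncard_eq_toFinset_card _ (Sset_finite n γ)]
  rw [h1, Finset.card_eq_sum_card_fiberwise (f := fun τ => τ x) (t := U)]
  · apply Finset.sum_congr rfl
    intro y _
    unfold Gc
    rw [← Set.ncard_coe_finset]
    congr 1
    ext τ; simp
  · intro τ hτ
    simp only [Set.Finite.coe_toFinset] at hτ
    by_contra hn
    have h2 := hU (τ x) ((inB_mem hτ.1).2 hx) hn
    unfold Gc at h2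
    rw [Set.ncard_eq_zero ((Sset_finite n γ).subset fun _ h => h.1)] at h2
    have : τ ∈ ({τ' | τ' ∈ Sset n γ ∧ τ' x = τ x} : Set _) := ⟨hτ, rfl⟩
    rw [h2] at this; exact this

/-! injectivity -/

noncomputable def ip (n : ℕ) (f g : ℤ → ℚ) : ℚ := ∑ x ∈ (signed_finite n).toFinset, f x * g x

lemma ip_inv {n : ℕ} {τ : Equiv.Perm ℤ} (hτ : inB n τ) (f g : ℤ → ℚ) :
    ip n (fun x => f (τ x)) (fun x => g (τ x)) = ip n f g := by
  unfold ip
  apply Finset.sum_bij (fun x _ => τ x)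
  · intro x hx; simpa [inB_mem hτ] using hx
  · intro a _ b _ h; exact τ.injective h
  · intro b hb
    refine ⟨τ⁻¹ b, ?_, by simp⟩
    simpa only [Set.Finite.mem_toFinset, inB_mem (inB_inv hτ)] using hb
  · intros; rfl

lemma ip_sub {n : ℕ} (f f' g : ℤ → ℚ) : ip n (f - f') g = ip n f g - ip n f' g := by
  simp [ip, sub_mul, Finset.sum_sub_distrib]

lemma ip_add {n : ℕ} (f g g' : ℤ → ℚ) : ip n f (g + g') = ip n f g + ip n f g' := by
  simp [ip, mul_add, Finset.sum_add_distrib]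

lemma ip_pos {n : ℕ} {f : ℤ → ℚ} (hf : f ∈ VV n) (h : ip n f f = 0) : f = 0 := by
  unfold ip at h
  rw [Finset.sum_eq_zero_iff_of_nonneg (fun _ _ => mul_self_nonneg _)] at h
  ext x
  by_cases hx : x ∈ signedSet n
  · simpa using h x (by simpa using hx)
  · exact hf.2 x hx

lemma ip_mov {n : ℕ} {τ : Equiv.Perm ℤ} (hτ : inB n τ) {f g : ℤ → ℚ} (hg : g ∈ Fx n τ) :
    ip n (fun x => f (τ x)) g = ip n f g := by
  rw [← ip_inv hτ f g]
  congr 1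
  ext x; exact (hg.2 x).symm

lemma VV_comp {n : ℕ} {τ : Equiv.Perm ℤ} (hτ : inB n τ) {f : ℤ → ℚ} (hf : f ∈ VV n) :
    (fun x => f (τ x)) ∈ VV n := by
  refine ⟨fun x => ?_, fun x hx => ?_⟩
  · simp only [hτ.1, hf.1]
  · simp only [hτ.2 x hx, hf.2 x hx]

lemma fix_sub {n : ℕ} {γ τ τ' : Equiv.Perm ℤ} (hγ : inB n γ) (hτ : inB n τ) (hτ' : inB n τ')
    (h' : le' n τ' γ) (hF : Fx n τ = Fx n τ') :
    Fx n (τ⁻¹ * γ) ≤ Fx n (τ'⁻¹ * γ) := by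
  intro f hf
  -- work with the action f ↦ f ∘ g⁻¹
  set σ' := τ'⁻¹ * γ with hσ'
  have hs' : inB n σ' := inB_mul (inB_inv hτ') hγ
  -- γ f = τ f
  have e1 : ∀ x, f (γ⁻¹ x) = f (τ⁻¹ x) := by
    intro x
    have := hf.2 (γ⁻¹ x)
    simpa using this.symm
  let u : ℤ → ℚ := fun x => f (σ'⁻¹ x)
  have hu : u ∈ VV n := VV_comp (inB_inv hs') hf.1
  have e2 : ∀ x, f (γ⁻¹ x) = u (τ'⁻¹ x) := by
    intro x; simp [u, hσ']
  have o1 : ∀ g ∈ Fx n τ', ip n (u - f) g = 0 := by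
    intro g hg
    have a1 : ip n (fun x => f (τ⁻¹ x)) g = ip n f g :=
      ip_mov (inB_inv hτ) (by rw [Fx_inv, hF]; exact hg)
    have a2 : ip n (fun x => u (τ'⁻¹ x)) g = ip n u g :=
      ip_mov (inB_inv hτ') (by rw [Fx_inv]; exact hg)
    have a3 : (fun x => f (τ⁻¹ x)) = (fun x => u (τ'⁻¹ x)) := by
      ext x; rw [← e1, e2]
    rw [ip_sub, ← a1, ← a2, a3, sub_self]
  have o2 : ∀ g ∈ Fx n σ', ip n (u - f) g = 0 := by
    intro g hg
    have a2 : ip n u g = ip n f g :=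
      ip_mov (inB_inv hs') (by rw [Fx_inv]; exact hg)
    rw [ip_sub, a2, sub_self]
  have hm : u - f ∈ VV n := sub_mem hu hf.1
  have h0 : u - f = 0 := by
    apply ip_pos hm
    have hm2 := hm
    rw [← le'_sup h', Submodule.mem_sup] at hm2
    obtain ⟨a, ha, b, hb, hab⟩ := hm2
    have : ip n (u - f) (a + b) = 0 := by rw [ip_add, o1 a ha, o2 b hb, add_zero]
    rwa [hab] at this
  have : f ∈ Fx n σ'⁻¹ := ⟨hf.1, fun x => by
    have := congrFun h0 x
    simp only [Pi.sub_apply, Pi.zero_apply, sub_eq_zero] at this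
    exact this⟩
  rwa [Fx_inv] at this

lemma eq_of_Fx {n : ℕ} {γ τ τ' : Equiv.Perm ℤ} (hγ : inB n γ) (hτ : inB n τ) (hτ' : inB n τ')
    (h : le' n τ γ) (h' : le' n τ' γ) (hF : Fx n τ = Fx n τ') : τ = τ' := by
  have hs := fix_sub hγ hτ hτ' h' hF
  have key : ∀ f ∈ VV n, ∀ x, f (τ⁻¹ x) = f (τ'⁻¹ x) := by
    intro f hf x
    rw [← le'_sup h, Submodule.mem_sup] at hf
    obtain ⟨a, ha, b, hb, rfl⟩ := hf
    have ha1 : a ∈ Fx n τ⁻¹ := by rwa [Fx_inv]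
    have ha2 : a ∈ Fx n τ'⁻¹ := by rwa [Fx_inv, ← hF]
    have hb1 := hb.2 (γ⁻¹ x)
    have hb2 := (hs hb).2 (γ⁻¹ x)
    have c1 := ha1.2 x
    have c2 := ha2.2 x
    simp at hb1 hb2 c1 c2
    simp [c1, c2, hb1, hb2]
  have : τ⁻¹ = τ'⁻¹ := by
    ext x
    by_cases hx : x ∈ signedSet n
    · have hz := (inB_mem (inB_inv hτ)).2 hx
      have := key (eL [τ⁻¹ x]) (eL_mem (by simpa using hz)) x
      have hz0 := hz.1
      have h3 : -τ⁻¹ x ≠ τ⁻¹ x := by intro; apply hz0; omega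
      by_contra hne
      have hne' : τ'⁻¹ x ≠ τ⁻¹ x := fun h => hne h.symm
      simp only [eL, List.mem_singleton, hne', h3] at this
      split_ifs at this <;> norm_num at *
    · rw [(inB_inv hτ).2 x hx, (inB_inv hτ').2 x hx]
  simpa using this

lemma permOrbit_self (τ : Equiv.Perm ℤ) (x : ℤ) : x ∈ permOrbit τ x := ⟨0, by simp⟩

lemma Fx_orbit {n : ℕ} {τ : Equiv.Perm ℤ} {f : ℤ → ℚ} (hf : f ∈ Fx n τ) {x y : ℤ}
    (h : y ∈ permOrbit τ x) : f y = f x := by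
  obtain ⟨m, rfl⟩ := h
  induction m using Int.induction_on generalizing x with
  | zero => simp
  | succ i ih =>
    rw [zpow_add, Equiv.Perm.mul_apply, ih]; simpa using hf.2 x
  | pred i ih =>
    rw [zpow_sub, Equiv.Perm.mul_apply, ih]
    have := hf.2 (τ⁻¹ x)
    simpa using this.symm

lemma Fx_omega {n : ℕ} {τ : Equiv.Perm ℤ} (hτ : inB n τ) {f : ℤ → ℚ} (hf : f ∈ VV n) :
    f ∈ Fx n τ ↔ ∀ A ∈ omegaTilde n τ, ∀ a ∈ A, ∀ b ∈ A, f a = f b := by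
  constructor
  · intro h A hA a ha b hb
    rcases hA with ⟨⟨x, hx, rfl⟩, _⟩ | ⟨rfl, _⟩
    · rw [Fx_orbit h ha, Fx_orbit h hb]
    · have key : ∀ c ∈ ⋃₀ {A | A ∈ orbitsOn n τ ∧ negSet A = A}, f c = 0 := by
        rintro c ⟨B, ⟨⟨x, hx, rfl⟩, h2⟩, hc⟩
        have h3 : -c ∈ permOrbit τ x := by
          rw [← h2] at hc; exact hc
        have h4 := Fx_orbit h hc
        have h5 := Fx_orbit h h3
        have := hf.1 c
        linarith
      rw [key a ha, key b hb]
  · intro h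
    refine ⟨hf, fun x => ?_⟩
    by_cases hx : x ∈ signedSet n
    · have m1 : x ∈ permOrbit τ x := permOrbit_self τ x
      have m2 : τ x ∈ permOrbit τ x := ⟨1, by simp⟩
      have ho : permOrbit τ x ∈ orbitsOn n τ := ⟨x, hx, rfl⟩
      by_cases hi : negSet (permOrbit τ x) = permOrbit τ x
      · have m3 : x ∈ ⋃₀ {A | A ∈ orbitsOn n τ ∧ negSet A = A} := ⟨_, ⟨ho, hi⟩, m1⟩
        exact h _ (Or.inr ⟨rfl, ⟨x, m3⟩⟩) _ ⟨_, ⟨ho, hi⟩, m2⟩ _ m3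
      · exact h _ (Or.inl ⟨ho, hi⟩) _ m2 _ m1
    · rw [hτ.2 x hx]

lemma omega_inj {n : ℕ} {γ τ τ' : Equiv.Perm ℤ} (hγ : inB n γ) (hτ : τ ∈ Sset n γ)
    (hτ' : τ' ∈ Sset n γ) (h : omegaTilde n τ = omegaTilde n τ') : τ = τ' := by
  apply eq_of_Fx hγ hτ.1 hτ'.1 hτ.2 hτ'.2
  ext f
  constructor
  · intro hf
    rw [Fx_omega hτ'.1 hf.1, ← h, ← Fx_omega hτ.1 hf.1]; exact hf
  · intro hf
    rw [Fx_omega hτ.1 hf.1, h, ← Fx_omega hτ'.1 hf.1]; exact hf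

lemma card_omega {n : ℕ} {γ : Equiv.Perm ℤ} (hγ : inB n γ) :
    {π | ∃ τ, inB n τ ∧ leB n τ γ ∧ π = omegaTilde n τ}.ncard = Nc n γ := by
  have : {π | ∃ τ, inB n τ ∧ leB n τ γ ∧ π = omegaTilde n τ} = omegaTilde n '' Sset n γ := by
    ext π
    constructor
    · rintro ⟨τ, h1, h2, rfl⟩
      exact ⟨τ, ⟨h1, (leB_iff h1 hγ).1 h2⟩, rfl⟩
    · rintro ⟨τ, ⟨h1, h2⟩, rfl⟩
      exact ⟨τ, h1, (leB_iff h1 hγ).2 h2, rfl⟩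
  rw [this, Nc]
  exact Set.InjOn.ncard_image fun a ha b hb h => omega_inj hγ ha hb h

def path (γ : Equiv.Perm ℤ) : ℤ → List ℤ → ℤ → Prop
  | x, [], w => γ x = w
  | x, a :: A, w => γ x = a ∧ path γ a A w

lemma path_append {γ : Equiv.Perm ℤ} {x z w : ℤ} {A B : List ℤ} :
    path γ x (A ++ z :: B) w ↔ path γ x A z ∧ path γ z B w := by
  induction A generalizing x with
  | nil => simp [path]
  | cons a A ih => simp [path, ih, and_assoc]

lemma path_neg {γ : Equiv.Perm ℤ} (hγ : ∀ x, γ (-x) = -γ x) {x w : ℤ} {A : List ℤ}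
    (h : path γ x A w) : path γ (-x) (A.map (fun a => -a)) (-w) := by
  induction A generalizing x with
  | nil => simp only [path, List.map_nil] at *; rw [hγ, h]
  | cons a A ih => simp only [path, List.map_cons] at *; exact ⟨by rw [hγ, h.1], ih h.2⟩

lemma path_sgn {γ : Equiv.Perm ℤ} (hγ : ∀ x, γ (-x) = -γ x) {x w : ℤ} {A : List ℤ} {σ : ℤ}
    (hσ : σ = 1 ∨ σ = -1)
    (h : path γ x A w) : path γ (σ * x) (A.map (fun a => σ * a)) (σ * w) := by
  rcases hσ with rfl | rfl
  · simpa using h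
  · simpa using path_neg hγ h

lemma path_T {γ t : Equiv.Perm ℤ} {x w : ℤ} {A : List ℤ}
    (h : path γ x A w) (ht : ∀ a ∈ A, t a = a) : path (t * γ) x A (t w) := by
  induction A generalizing x with
  | nil => simp only [path] at *; simp [h]
  | cons a A ih =>
    simp only [path] at *
    exact ⟨by simp [h.1, ht a], ih h.2 fun b hb => ht b (by simp [hb])⟩

lemma path_fx {γ : Equiv.Perm ℤ} {f : ℤ → ℚ} (hf : ∀ x, f (γ x) = f x) {x w : ℤ} {A : List ℤ}
    (h : path γ x A w) : (∀ a ∈ A, f a = f x) ∧ f w = f x := by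
  induction A generalizing x with
  | nil => simp only [path] at *; simp [← h, hf]
  | cons a A ih =>
    simp only [path] at *
    have := ih h.2
    have h3 : f a = f x := by rw [← h.1, hf]
    refine ⟨?_, by rw [this.2, h3]⟩
    intro b hb
    rcases List.mem_cons.1 hb with rfl | hb
    · exact h3
    · rw [this.1 b hb, h3]

lemma path_fwd {γ : Equiv.Perm ℤ} {x w : ℤ} {A : List ℤ} (h : path γ x A w) :
    ∀ a ∈ x :: A, γ a ∈ A ++ [w] := by
  induction A generalizing x with
  | nil => simp only [path] at *; simp [h]
  | cons a A ih =>
    simp only [path] at *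
    intro b hb
    rcases List.mem_cons.1 hb with rfl | hb
    · simp [h.1]
    · have := ih h.2 b hb
      exact List.mem_cons_of_mem _ this

lemma path_bwd {γ : Equiv.Perm ℤ} {x w : ℤ} {A : List ℤ} (h : path γ x A w) :
    ∀ b ∈ A ++ [w], ∃ a ∈ x :: A, γ a = b := by
  induction A generalizing x with
  | nil => simp only [path] at *; simp [h]
  | cons a A ih =>
    simp only [path] at *
    intro b hb
    rcases List.mem_cons.1 hb with rfl | hb
    · exact ⟨x, by simp, h.1⟩
    · obtain ⟨c, hc, h4⟩ := ih h.2 b hb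
      exact ⟨c, List.mem_cons_of_mem _ hc, h4⟩

lemma path_closed {γ : Equiv.Perm ℤ} {x : ℤ} {A : List ℤ} (h : path γ x A x) (w : ℤ) :
    γ w ∈ x :: A ↔ w ∈ x :: A := by
  have e : ∀ b, b ∈ A ++ [x] ↔ b ∈ x :: A := by intro b; simp [or_comm]
  constructor
  · intro hw
    obtain ⟨a, ha, h2⟩ := path_bwd h _ ((e _).2 hw)
    rwa [← γ.injective h2]
  · intro hw
    exact (e _).1 (path_fwd h w hw)

def cyc (γ : Equiv.Perm ℤ) (ε : ℤ) : List ℤ → Prop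
  | [] => True
  | x :: A => path γ x A (ε * x)

/-- absolute values of the points -/
def K (S : List (ℤ × List ℤ)) : List ℕ := (S.flatMap Prod.snd).map Int.natAbs

lemma K_append (C R : List (ℤ × List ℤ)) : K (C ++ R) = K C ++ K R := by simp [K]
lemma K_cons (c : ℤ × List ℤ) (R : List (ℤ × List ℤ)) :
    K (c :: R) = c.2.map Int.natAbs ++ K R := by simp [K]
lemma K_nil : K [] = [] := rfl

lemma mem_K {S : List (ℤ × List ℤ)} {c : ℤ × List ℤ} (hc : c ∈ S) {z : ℤ} (hz : z ∈ c.2) :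
    z.natAbs ∈ K S := by
  unfold K
  exact List.mem_map_of_mem (List.mem_flatMap.2 ⟨c, hc, hz⟩)

structure St (n : ℕ) (γ : Equiv.Perm ℤ) (S : List (ℤ × List ℤ)) : Prop where
  inb : inB n γ
  sg : ∀ c ∈ S, c.1 = 1 ∨ c.1 = -1
  rng : ∀ k ∈ K S, 1 ≤ k ∧ k ≤ n
  nd : (K S).Nodup
  cy : ∀ c ∈ S, cyc γ c.1 c.2
  out : ∀ w : ℤ, w.natAbs ∉ K S → γ w = w

lemma signed_natAbs {n : ℕ} {z : ℤ} : z ∈ signedSet n ↔ 1 ≤ z.natAbs ∧ z.natAbs ≤ n := by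
  simp only [signedSet, Set.mem_ofPred_eq, Int.abs_eq_natAbs]
  omega

lemma St.sgn {n : ℕ} {γ : Equiv.Perm ℤ} {S : List (ℤ × List ℤ)} (h : St n γ S)
    {c : ℤ × List ℤ} (hc : c ∈ S) {z : ℤ} (hz : z ∈ c.2) : z ∈ signedSet n :=
  signed_natAbs.2 (h.rng _ (mem_K hc hz))

lemma St.perm {n : ℕ} {γ : Equiv.Perm ℤ} {S S' : List (ℤ × List ℤ)} (h : St n γ S)
    (hp : S.Perm S') : St n γ S' := by
  have hK : (K S).Perm (K S') := (List.Perm.flatMap_right _ hp).map _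
  exact ⟨h.inb, fun c hc => h.sg c (hp.mem_iff.2 hc), fun k hk => h.rng k (hK.mem_iff.2 hk),
    hK.nodup_iff.1 h.nd, fun c hc => h.cy c (hp.mem_iff.2 hc),
    fun w hw => h.out w fun h' => hw (hK.mem_iff.1 h')⟩

lemma natAbs_sg {ε u : ℤ} (h : ε = 1 ∨ ε = -1) : (ε * u).natAbs = u.natAbs := by
  rcases h with rfl | rfl <;> simp

lemma St.trans {n : ℕ} {γ t : Equiv.Perm ℤ} {C C' R : List (ℤ × List ℤ)} {E : List ℕ}
    (h : St n γ (C ++ R)) (ht : inB n t) (ht2 : ∀ w : ℤ, w.natAbs ∉ K C → t w = w)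
    (hK : (K C).Perm (E ++ K C')) (hE : ∀ w : ℤ, w.natAbs ∈ E → (t * γ) w = w)
    (hs : ∀ c ∈ C', c.1 = 1 ∨ c.1 = -1) (hc : ∀ c ∈ C', cyc (t * γ) c.1 c.2) :
    St n (t * γ) (C' ++ R) := by
  have hnd := h.nd
  rw [K_append] at hnd
  have hnd2 : (E ++ K C' ++ K R).Nodup := (hK.append_right (K R)).nodup_iff.1 hnd
  have hdis : ∀ k ∈ K R, k ∉ K C := fun k hk hk' => (List.disjoint_of_nodup_append hnd) hk' hk
  refine ⟨inB_mul ht h.inb, ?_, ?_, ?_, ?_, ?_⟩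
  · intro c hc
    rcases List.mem_append.1 hc with hc | hc
    · exact hs c hc
    · exact h.sg c (List.mem_append_right _ hc)
  · intro k hk
    apply h.rng
    rw [K_append] at *
    rcases List.mem_append.1 hk with hk | hk
    · exact List.mem_append_left _ (hK.mem_iff.2 (List.mem_append_right _ hk))
    · exact List.mem_append_right _ hk
  · rw [K_append]
    rw [List.append_assoc] at hnd2
    exact (List.nodup_append.1 hnd2).2.1
  · rintro ⟨ε, L⟩ hc'
    rcases List.mem_append.1 hc' with hc' | hc'
    · exact hc _ hc'
    · have h1 := h.cy _ (List.mem_append_right C hc')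
      have h2 := h.sg _ (List.mem_append_right C hc')
      cases L with
      | nil => trivial
      | cons u U =>
        simp only [cyc] at *
        have h3 : t (ε * u) = ε * u := by
          apply ht2
          rw [natAbs_sg h2]
          exact hdis _ (mem_K hc' (by simp))
        rw [← h3]
        apply path_T h1
        intro a ha
        apply ht2
        exact hdis _ (mem_K hc' (by simp [ha]))
  · intro w hw
    rw [K_append, List.mem_append, not_or] at hw
    by_cases h1 : w.natAbs ∈ K C
    · rw [hK.mem_iff, List.mem_append] at h1
      exact hE w (h1.resolve_right hw.1)
    · have : γ w = w := h.out w (by rw [K_append, List.mem_append, not_or]; exact ⟨h1, hw.2⟩)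
      simp [this, ht2 w h1]

lemma T_fix {x y w : ℤ} (hx : x ≠ 0) (hy : y ≠ 0) (h1 : w.natAbs ≠ x.natAbs)
    (h2 : w.natAbs ≠ y.natAbs) : T x y w = w := by
  rw [T_apply hx hy]
  grind

lemma T_sgn {x z σ : ℤ} (hx : x ≠ 0) (hz : z ≠ 0) (hσ : σ = 1 ∨ σ = -1) :
    T x (σ * z) z = σ * x := by
  rcases hσ with rfl | rfl
  · simp [T_right hx hz]
  · rw [T_apply hx (by simpa)]
    grind

lemma inB_sgn {n : ℕ} {t : Equiv.Perm ℤ} (ht : inB n t) {x ε : ℤ} (h : ε = 1 ∨ ε = -1) :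
    t (ε * x) = ε * t x := by
  rcases h with rfl | rfl
  · simp
  · simp [ht.1]

lemma sgn_signed {n : ℕ} {x ε : ℤ} (h : ε = 1 ∨ ε = -1) (hx : x ∈ signedSet n) :
    ε * x ∈ signedSet n := by
  rw [signed_natAbs, natAbs_sg h, ← signed_natAbs]; exact hx

lemma sg_mul {a b : ℤ} (h : a = 1 ∨ a = -1) (h' : b = 1 ∨ b = -1) : a * b = 1 ∨ a * b = -1 := by
  rcases h with rfl | rfl <;> rcases h' with rfl | rfl <;> simp

lemma St.split {n : ℕ} {γ : Equiv.Perm ℤ} {R : List (ℤ × List ℤ)} {ε σ x z : ℤ} {A1 A2 : List ℤ}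
    (h : St n γ ((ε, x :: (A1 ++ z :: A2)) :: R)) (hσ : σ = 1 ∨ σ = -1) :
    St n (T x (σ * z) * γ) ((σ, x :: A1) :: (σ * ε, z :: A2) :: R) := by
  have hε : ε = 1 ∨ ε = -1 := h.sg _ List.mem_cons_self
  have hx : x ∈ signedSet n := h.sgn List.mem_cons_self (by simp)
  have hz : z ∈ signedSet n := h.sgn List.mem_cons_self (by simp)
  have hy := sgn_signed hσ hz
  have ht := T_inB hx hy
  have hnd := h.nd
  rw [K_cons] at hnd
  have hp := h.cy _ List.mem_cons_self
  simp only [cyc, path_append] at hp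
  simp only [List.map_cons, List.map_append, List.cons_append, List.append_assoc, List.nodup_cons,
    List.mem_append, List.mem_cons, List.nodup_append] at hnd
  have hfix : ∀ a ∈ A1 ++ A2, T x (σ * z) a = a := by
    intro a ha
    apply T_fix hx.1 hy.1
    · intro h'
      apply hnd.1
      rcases List.mem_append.1 ha with ha | ha
      · exact Or.inl (h' ▸ List.mem_map_of_mem ha)
      · exact Or.inr (Or.inr (Or.inl (h' ▸ List.mem_map_of_mem ha)))
    · rw [natAbs_sg hσ]
      intro h'
      rcases List.mem_append.1 ha with ha | ha
      · exact hnd.2.2.2 _ (List.mem_map_of_mem ha) _ (Or.inl rfl) h'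
      · exact hnd.2.2.1.1 (Or.inl (h' ▸ List.mem_map_of_mem ha))
  refine St.trans (C := [(ε, x :: (A1 ++ z :: A2))]) (C' := [(σ, x :: A1), (σ * ε, z :: A2)])
    (E := []) (R := R) h ht ?_ ?_ ?_ ?_ ?_
  · intro w hw
    apply T_fix hx.1 hy.1
    · intro h'; apply hw; simp [K, h']
    · rw [natAbs_sg hσ]; intro h'; apply hw; simp [K, h']
  · simp [K]
  · simp
  · simp only [List.mem_cons, List.not_mem_nil, or_false, forall_eq_or_imp, forall_eq]
    exact ⟨hσ, sg_mul hσ hε⟩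
  · simp only [List.mem_cons, List.not_mem_nil, or_false, forall_eq_or_imp, forall_eq, cyc]
    constructor
    · have := path_T (t := T x (σ * z)) hp.1 fun a ha => hfix a (by simp [ha])
      rwa [T_sgn hx.1 hz.1 hσ] at this
    · have := path_T (t := T x (σ * z)) hp.2 fun a ha => hfix a (by simp [ha])
      rw [inB_sgn ht hε, T_left hx.1 hy.1] at this
      rwa [show σ * ε * z = ε * (σ * z) by ring]

lemma St.flip {n : ℕ} {γ : Equiv.Perm ℤ} {R : List (ℤ × List ℤ)} {ε x : ℤ} {A : List ℤ}
    (h : St n γ ((ε, x :: A) :: R)) :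
    St n (T x (-x) * γ) ((-ε, x :: A) :: R) := by
  have hε : ε = 1 ∨ ε = -1 := h.sg _ List.mem_cons_self
  have hx : x ∈ signedSet n := h.sgn List.mem_cons_self (by simp)
  have hy := neg_signed.2 hx
  have ht := T_inB hx hy
  have hnd := h.nd
  rw [K_cons] at hnd
  have hp := h.cy _ List.mem_cons_self
  simp only [cyc] at hp
  simp only [List.map_cons, List.cons_append, List.nodup_cons, List.mem_append] at hnd
  have hfix : ∀ a ∈ A, T x (-x) a = a := by
    intro a ha
    have : a.natAbs ≠ x.natAbs := by
      intro h'
      apply hnd.1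
      exact Or.inl (h' ▸ List.mem_map_of_mem ha)
    apply T_fix hx.1 hy.1 this
    simpa using this
  refine St.trans (C := [(ε, x :: A)]) (C' := [(-ε, x :: A)])
    (E := []) (R := R) h ht ?_ ?_ ?_ ?_ ?_
  · intro w hw
    have : w.natAbs ≠ x.natAbs := by
      intro h'; apply hw; simp [K, h']
    apply T_fix hx.1 hy.1 this
    simpa using this
  · simp [K]
  · simp
  · simp only [List.mem_cons, List.not_mem_nil, or_false, forall_eq]
    rcases hε with rfl | rfl <;> simp
  · simp only [List.mem_cons, List.not_mem_nil, or_false, forall_eq, cyc]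
    have := path_T (t := T x (-x)) hp fun a ha => hfix a (by simp [ha])
    rw [inB_sgn ht hε, T_left hx.1 hy.1] at this
    rwa [show -ε * x = ε * (-x) by ring]

lemma map_natAbs_sg {σ : ℤ} (h : σ = 1 ∨ σ = -1) (L : List ℤ) :
    (L.map (fun a => σ * a)).map Int.natAbs = L.map Int.natAbs := by
  rw [List.map_map]
  apply List.map_congr_left
  intro a _
  exact natAbs_sg h

lemma St.merge {n : ℕ} {γ : Equiv.Perm ℤ} {R : List (ℤ × List ℤ)} {ε ε' σ x z : ℤ} {A B : List ℤ}
    (h : St n γ ((ε, x :: A) :: (ε', z :: B) :: R)) (hσ : σ = 1 ∨ σ = -1) :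
    St n (T x (σ * z) * γ)
      ((ε * ε', x :: (A ++ (z :: B).map (fun a => ε * σ * a))) :: R) := by
  have hε : ε = 1 ∨ ε = -1 := h.sg _ List.mem_cons_self
  have hε' : ε' = 1 ∨ ε' = -1 := h.sg (ε', z :: B) (by simp)
  have hx : x ∈ signedSet n := h.sgn List.mem_cons_self (by simp)
  have hz : z ∈ signedSet n := h.sgn (c := (ε', z :: B)) (by simp) (by simp)
  have hy := sgn_signed hσ hz
  have ht := T_inB hx hy
  have hnd := h.nd
  rw [K_cons, K_cons] at hnd
  have hp := h.cy _ List.mem_cons_self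
  have hq := h.cy (ε', z :: B) (by simp)
  simp only [cyc] at hp hq
  simp only [List.map_cons, List.cons_append, List.nodup_cons,
    List.mem_append, List.mem_cons, List.nodup_append] at hnd
  have hfix : ∀ a ∈ A ++ B, T x (σ * z) a = a := by
    intro a ha
    apply T_fix hx.1 hy.1
    · intro h'
      apply hnd.1
      rcases List.mem_append.1 ha with ha | ha
      · exact Or.inl (h' ▸ List.mem_map_of_mem ha)
      · exact Or.inr (Or.inr (Or.inl (h' ▸ List.mem_map_of_mem ha)))
    · rw [natAbs_sg hσ]
      intro h'
      rcases List.mem_append.1 ha with ha | ha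
      · exact hnd.2.2.2 _ (List.mem_map_of_mem ha) _ (Or.inl rfl) h'
      · exact hnd.2.2.1.1 (Or.inl (h' ▸ List.mem_map_of_mem ha))
  refine St.trans (C := [(ε, x :: A), (ε', z :: B)])
    (C' := [(ε * ε', x :: (A ++ (z :: B).map (fun a => ε * σ * a)))])
    (E := []) (R := R) h ht ?_ ?_ ?_ ?_ ?_
  · intro w hw
    apply T_fix hx.1 hy.1
    · intro h'; apply hw; simp [K, h']
    · rw [natAbs_sg hσ]; intro h'; apply hw; simp [K, h']
  · simp only [K_cons, K_nil, List.map_cons (f := Int.natAbs), List.map_append,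
      map_natAbs_sg (sg_mul hε hσ)]
    simp
  · simp
  · simp only [List.mem_cons, List.not_mem_nil, or_false, forall_eq]
    exact sg_mul hε hε'
  · simp only [List.mem_cons, List.not_mem_nil, or_false, forall_eq, cyc, List.map_cons,
      path_append]
    constructor
    · have := path_T (t := T x (σ * z)) hp fun a ha => hfix a (by simp [ha])
      rw [inB_sgn ht hε, T_left hx.1 hy.1] at this
      rwa [show ε * σ * z = ε * (σ * z) by ring]
    · have := path_T (t := T x (σ * z)) hq fun a ha => hfix a (by simp [ha])
      rw [inB_sgn ht hε', T_sgn hx.1 hz.1 hσ] at this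
      have := path_sgn (inB_mul ht h.inb).1 (sg_mul hε hσ) this
      have e : ε * σ * (ε' * (σ * x)) = ε * ε' * x := by
        have : σ * σ = 1 := by rcases hσ with rfl | rfl <;> simp
        calc ε * σ * (ε' * (σ * x)) = (σ * σ) * (ε * ε' * x) := by ring
          _ = _ := by rw [this, one_mul]
      rwa [e] at this

lemma St.remove {n : ℕ} {β : Equiv.Perm ℤ} {R : List (ℤ × List ℤ)} {ε x : ℤ} {A : List ℤ}
    (h : St n β ((ε, x :: A) :: R)) :
    St n (T x (β x) * β) ((ε, A) :: R) := by
  have hε : ε = 1 ∨ ε = -1 := h.sg _ List.mem_cons_self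
  have hx : x ∈ signedSet n := h.sgn List.mem_cons_self (by simp)
  have hy := (inB_mem h.inb).2 hx
  have ht := T_inB hx hy
  have hnd := h.nd
  rw [K_cons] at hnd
  have hp := h.cy _ List.mem_cons_self
  simp only [cyc] at hp
  simp only [List.map_cons, List.cons_append, List.nodup_cons, List.mem_append] at hnd
  have hb : (β x).natAbs ∈ K [(ε, x :: A)] := by
    have := path_fwd hp x (by simp)
    rcases List.mem_append.1 this with h1 | h1
    · exact mem_K (c := (ε, x :: A)) (by simp) (by simp [h1])
    · rw [List.mem_singleton] at h1
      rw [h1, natAbs_sg hε]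
      exact mem_K (c := (ε, x :: A)) (by simp) (by simp)
  have hfx : (T x (β x) * β) x = x := by simp [T_right hx.1 hy.1]
  refine St.trans (C := [(ε, x :: A)]) (C' := [(ε, A)])
    (E := [x.natAbs]) (R := R) h ht ?_ ?_ ?_ ?_ ?_
  · intro w hw
    apply T_fix hx.1 hy.1
    · intro h'; apply hw; simp [K, h']
    · intro h'; apply hw; rw [h']; exact hb
  · simp [K]
  · intro w hw
    rw [List.mem_singleton, Int.natAbs_eq_natAbs_iff] at hw
    rcases hw with rfl | rfl
    · exact hfx
    · rw [(inB_mul ht h.inb).1, hfx]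
  · simpa using hε
  · simp only [List.mem_cons, List.not_mem_nil, or_false, forall_eq]
    cases A with
    | nil => trivial
    | cons a A =>
      simp only [cyc, path] at *
      obtain ⟨hp1, hp2⟩ := hp
      rw [hp1] at ht hy hfx ⊢
      have := path_T (t := T x a) hp2 fun b hb => by
        simp only [List.map_cons, List.cons_append, List.nodup_cons, List.mem_append,
          List.mem_cons] at hnd
        apply T_fix hx.1 hy.1
        · intro h'
          exact hnd.1 (Or.inl (Or.inr (h' ▸ List.mem_map_of_mem hb)))
        · intro h'
          exact hnd.2.1 (Or.inl (h' ▸ List.mem_map_of_mem hb))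
      rwa [inB_sgn ht hε, T_left hx.1 hy.1] at this

lemma St.rotate {n : ℕ} {γ : Equiv.Perm ℤ} {R : List (ℤ × List ℤ)} {ε z : ℤ} {A B : List ℤ}
    (h : St n γ ((ε, A ++ z :: B) :: R)) :
    St n γ ((ε, z :: (B ++ A.map (fun a => ε * a))) :: R) := by
  have hε : ε = 1 ∨ ε = -1 := h.sg _ List.mem_cons_self
  have hp := h.cy _ List.mem_cons_self
  rw [← one_mul γ]
  refine St.trans (C := [(ε, A ++ z :: B)]) (C' := [(ε, z :: (B ++ A.map (fun a => ε * a)))])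
    (E := []) (R := R) h (inB_one n) ?_ ?_ ?_ ?_ ?_
  · simp
  · simp only [K_cons, K_nil, List.map_append, List.map_cons, map_natAbs_sg hε, List.append_nil,
      List.nil_append]
    refine List.perm_append_comm.trans ?_
    simp
  · simp
  · simpa using hε
  · simp only [List.mem_cons, List.not_mem_nil, or_false, forall_eq, one_mul]
    cases A with
    | nil => simpa using hp
    | cons x A =>
      simp only [cyc, List.cons_append, path_append] at hp
      simp only [cyc, List.map_cons, path_append]
      exact ⟨hp.2, path_sgn h.inb.1 hε hp.1⟩

def Bq (p : ℕ) : ℚ := (Nat.centralBinom p : ℚ)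
noncomputable def Ct (p : ℕ) : ℚ := (catalan p : ℚ)

lemma Bq_zero : Bq 0 = 1 := by simp [Bq]
lemma Ct_zero : Ct 0 = 1 := by simp [Ct]

lemma Bq_succ (m : ℕ) : Bq (m + 1) = 2 * (2 * m + 1) / (m + 1) * Bq m := by
  have := Nat.succ_mul_centralBinom_succ m
  have h : ((m : ℚ) + 1) * Bq (m + 1) = 2 * (2 * m + 1) * Bq m := by
    unfold Bq; exact_mod_cast this
  have : (m : ℚ) + 1 ≠ 0 := by positivity
  field_simp
  linarith

lemma Ct_eq (q : ℕ) : Ct q = Bq q / (q + 1) := by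
  have := succ_mul_catalan_eq_centralBinom q
  have h : ((q : ℚ) + 1) * Ct q = Bq q := by
    unfold Bq Ct; exact_mod_cast this
  have : (q : ℚ) + 1 ≠ 0 := by positivity
  field_simp
  linarith

lemma Ct_succ (m : ℕ) : Ct (m + 1) = ∑ i ∈ Finset.range (m + 1), Ct i * Ct (m - i) := by
  unfold Ct
  rw [catalan_succ, ← Fin.sum_univ_eq_sum_range (fun i => (catalan i : ℚ) * (catalan (m - i) : ℚ))]
  push_cast
  rfl

def sq (p q : ℕ) : ℚ := p / (2 * (p + q)) * Bq p * Bq q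

lemma sq_zero (q : ℕ) : sq 0 q = 0 := by simp [sq]

lemma sq_succ (m q : ℕ) : sq (m + 1) q = Bq m * Ct q + sq m (q + 1) := by
  unfold sq
  rw [Ct_eq, Bq_succ, Bq_succ]
  push_cast
  have h1 : (m : ℚ) + 1 ≠ 0 := by positivity
  have h2 : (q : ℚ) + 1 ≠ 0 := by positivity
  have h3 : (m : ℚ) + 1 + q ≠ 0 := by positivity
  have h4 : (m : ℚ) + (q + 1) ≠ 0 := by positivity
  have h5 : (m : ℚ) + (q + 1) = m + 1 + q := by ring
  rw [h5]
  field_simp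
  ring

lemma sq_sum (m q : ℕ) : sq (m + 1) q = ∑ i ∈ Finset.range (m + 1), Bq i * Ct (q + (m - i)) := by
  induction m generalizing q with
  | zero => simp [sq_succ, sq_zero]
  | succ m ih =>
    rw [sq_succ, ih, Finset.sum_range_succ (n := m + 1), add_comm]
    simp only [Nat.sub_self, add_zero]
    congr 1
    apply Finset.sum_congr rfl
    intro i hi
    rw [Finset.mem_range] at hi
    congr 2
    omega

lemma Bq_rec (m : ℕ) : Bq (m + 1) = 2 * ∑ i ∈ Finset.range (m + 1), Ct (m - i) * Bq i := by
  have := sq_sum m 0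
  simp only [zero_add] at this
  have e : sq (m + 1) 0 = Bq (m + 1) / 2 := by
    unfold sq
    rw [Bq_zero]; push_cast
    have h1 : (m : ℚ) + 1 ≠ 0 := by positivity
    field_simp
    ring
  rw [e] at this
  have h2 : ∑ i ∈ Finset.range (m + 1), Ct (m - i) * Bq i =
      ∑ i ∈ Finset.range (m + 1), Bq i * Ct (m - i) :=
    Finset.sum_congr rfl fun i _ => mul_comm _ _
  rw [h2, ← this]; ring

lemma sq_rec (m q : ℕ) :
    sq (m + 1) q = 2 * ∑ i ∈ Finset.range (m + 1), Ct (m - i) * sq i q + Ct (m + q) := by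
  induction m generalizing q with
  | zero => simp [sq_succ, sq_zero, Bq_zero]
  | succ m ih =>
    rw [sq_succ, ih, Finset.sum_range_succ' (fun i => Ct (m + 1 - i) * sq i q) (m + 1), sq_zero, mul_zero,
      add_zero, Bq_rec]
    have e : ∀ i, Ct (m + 1 - (i + 1)) * sq (i + 1) q =
        Ct (m - i) * Bq i * Ct q + Ct (m - i) * sq i (q + 1) := by
      intro i
      rw [sq_succ, Nat.add_sub_add_right]; ring
    simp only [e, Finset.sum_add_distrib, ← Finset.sum_mul]
    rw [show m + (q + 1) = m + 1 + q by ring]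
    ring

def Ep (p q : ℕ) : ℚ := 2 * q * sq p q

def DD : List ℕ → ℚ
  | [] => 1
  | p :: l => Bq p * DD l + ∑ i : Fin l.length, Ep p l[i] * DD (l.eraseIdx i)
termination_by l => l.length
decreasing_by
  · simp
  · simp [List.length_eraseIdx]

lemma DD_nil : DD [] = 1 := by rw [DD]
lemma DD_cons (p : ℕ) (l : List ℕ) :
    DD (p :: l) = Bq p * DD l + ∑ i : Fin l.length, Ep p l[i] * DD (l.eraseIdx i) := by
  rw [DD]

lemma DD_zero (l : List ℕ) : DD (0 :: l) = DD l := by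
  simp [DD_cons, Ep, sq_zero, Bq_zero]

lemma DD_rec (m : ℕ) (l : List ℕ) :
    DD ((m + 1) :: l) = 2 * ∑ i ∈ Finset.range (m + 1), Ct (m - i) * DD (i :: l) +
      ∑ j : Fin l.length, 2 * (l[j] : ℚ) * Ct (m + l[j]) * DD (l.eraseIdx j) := by
  simp only [DD_cons, mul_add, Finset.sum_add_distrib, Finset.mul_sum]
  rw [Finset.sum_comm, add_assoc, ← Finset.sum_add_distrib, Bq_rec]
  congr 1
  · rw [Finset.mul_sum, Finset.sum_mul]
    exact Finset.sum_congr rfl fun i _ => by ring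
  · apply Finset.sum_congr rfl
    intro j _
    simp only [Ep]
    rw [sq_rec, mul_add, Finset.mul_sum, Finset.mul_sum, add_mul, Finset.sum_mul]
    congr 1
    · exact Finset.sum_congr rfl fun i _ => by ring

lemma DD_three (a b c : ℕ) (ha : 1 ≤ a) (hb : 1 ≤ b) (hc : 1 ≤ c) : DD [a, b, c] =
    (1 + ((a : ℚ) * b) / ((a : ℚ) + b) + ((a : ℚ) * c) / ((a : ℚ) + c) +
          ((b : ℚ) * c) / ((b : ℚ) + c)) *
        (Nat.choose (2 * a) a : ℚ) * (Nat.choose (2 * b) b : ℚ) *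
        (Nat.choose (2 * c) c : ℚ) := by
  simp only [DD_cons, DD_nil, Fin.sum_univ_succ, List.length_cons, List.length_nil]
  simp [Ep, sq, DD_cons, DD_nil, Bq, Nat.centralBinom_eq_two_mul_choose]
  have : (a : ℚ) ≠ 0 := by positivity
  have : (b : ℚ) ≠ 0 := by positivity
  have : (a : ℚ) + b ≠ 0 := by positivity
  have : (a : ℚ) + c ≠ 0 := by positivity
  have : (b : ℚ) + c ≠ 0 := by positivity
  field_simp
  ring

lemma eL_one {P : List ℤ} {x : ℤ} (hn : (P.map Int.natAbs).Nodup) (hx : x ∈ P) (h0 : x ≠ 0) :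
    eL P x = 1 := by
  have : -x ∉ P := by
    intro h
    have := List.inj_on_of_nodup_map hn h hx (by simp)
    omega
  simp [eL, hx, this]

lemma eL_neg (P : List ℤ) (x : ℤ) : eL P (-x) = -eL P x := by
  simp [eL]

lemma eL_zero {P : List ℤ} {x : ℤ} (h : x.natAbs ∉ P.map Int.natAbs) : eL P x = 0 := by
  have h1 : x ∉ P := fun h' => h (List.mem_map_of_mem h')
  have h2 : -x ∉ P := fun h' => h (by simpa using List.mem_map_of_mem (f := Int.natAbs) h')
  simp [eL, h1, h2]

lemma St.nd1 {n : ℕ} {γ : Equiv.Perm ℤ} {S : List (ℤ × List ℤ)} (h : St n γ S)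
    {c : ℤ × List ℤ} (hc : c ∈ S) : (c.2.map Int.natAbs).Nodup := by
  obtain ⟨s, t, rfl⟩ := List.append_of_mem hc
  have := h.nd
  simp only [K_append, K_cons] at this
  exact (List.nodup_append.1 (List.nodup_append.1 this).2.1).1

lemma St.eLFx {n : ℕ} {γ : Equiv.Perm ℤ} {S : List (ℤ × List ℤ)} (h : St n γ S)
    {P : List ℤ} (hc : ((1 : ℤ), P) ∈ S) : eL P ∈ Fx n γ := by
  refine eL_Fx h.inb (fun z hz => h.sgn hc hz) ?_
  cases P with
  | nil => simp
  | cons x A =>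
    have := h.cy _ hc
    simp only [cyc, one_mul] at this
    exact path_closed this

lemma St.fx {n : ℕ} {γ : Equiv.Perm ℤ} {S : List (ℤ × List ℤ)} (h : St n γ S)
    {ε x : ℤ} {A : List ℤ} (hc : (ε, x :: A) ∈ S) {f : ℤ → ℚ} (hf : f ∈ Fx n γ) :
    ∀ a ∈ A, f a = f x :=
  (path_fx hf.2 (h.cy _ hc)).1

lemma St.fx0 {n : ℕ} {γ : Equiv.Perm ℤ} {S : List (ℤ × List ℤ)} (h : St n γ S)
    {L : List ℤ} (hc : ((-1 : ℤ), L) ∈ S) {f : ℤ → ℚ} (hf : f ∈ Fx n γ) :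
    ∀ a ∈ L, f a = 0 := by
  cases L with
  | nil => simp
  | cons x A =>
    have h1 := path_fx hf.2 (h.cy _ hc)
    have h2 : f (-1 * x) = f x := h1.2
    have h3 := (mem_VV.1 hf.1).1 x
    have h4 : f x = 0 := by
      rw [neg_one_mul, h3] at h2
      linarith
    intro a ha
    rcases List.mem_cons.1 ha with rfl | ha
    · exact h4
    · rw [h1.1 a ha, h4]

lemma drop_rr {n : ℕ} {γ : Equiv.Perm ℤ} {S' : List (ℤ × List ℤ)} {x y : ℤ} {P : List ℤ}
    (hx : x ∈ signedSet n) (hy : y ∈ signedSet n) (hall : ∀ f ∈ Fx n γ, f x = f y)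
    (h' : St n (T x y * γ) S') (hP : ((1 : ℤ), P) ∈ S') (hne : eL P x ≠ eL P y) :
    rr n (T x y * γ) + 1 = rr n γ := by
  refine rr_lt_of hx hy ?_ (h'.eLFx hP) fun hf => hne (hall _ hf)
  intro f hf
  exact (mem_FxT hx hy).2 ⟨hf.1, hall f hf⟩

lemma Gc_self {n : ℕ} {γ : Equiv.Perm ℤ} {R : List (ℤ × List ℤ)} {ε x : ℤ} {A : List ℤ}
    (h : St n γ ((ε, x :: A) :: R)) :
    ∃ γ', St n γ' ((ε, A) :: R) ∧ Gc n γ x x = Nc n γ' := by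
  have hx : x ∈ signedSet n := h.sgn List.mem_cons_self List.mem_cons_self
  refine ⟨_, ?_, Gc_eq h.inb hx hx (Or.inl rfl)⟩
  rw [T_self, one_mul]
  exact h.remove

lemma Gc_splitp {n : ℕ} {γ : Equiv.Perm ℤ} {R : List (ℤ × List ℤ)} {ε x z : ℤ} {A1 A2 : List ℤ}
    (h : St n γ ((ε, x :: (A1 ++ z :: A2)) :: R)) :
    ∃ γ', St n γ' ((1, A1) :: (ε, z :: A2) :: R) ∧ Gc n γ x z = Nc n γ' := by
  have hx : x ∈ signedSet n := h.sgn List.mem_cons_self List.mem_cons_self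
  have hz : z ∈ signedSet n := h.sgn (z := z) List.mem_cons_self (by simp)
  have hs := h.split (σ := 1) (Or.inl rfl)
  rw [one_mul, one_mul] at hs
  refine ⟨_, hs.remove, Gc_eq h.inb hx hz (Or.inr ?_)⟩
  refine drop_rr hx hz ?_ hs List.mem_cons_self ?_
  · intro f hf
    exact (h.fx List.mem_cons_self hf z (by simp)).symm
  · have h1 := h.nd1 List.mem_cons_self
    rw [eL_one (hs.nd1 List.mem_cons_self) List.mem_cons_self hx.1, eL_zero]
    · norm_num
    · intro h2
      simp only [List.map_cons, List.map_append, ← List.cons_append] at h1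
      exact (List.disjoint_of_nodup_append h1) h2 (by simp)

lemma Gc_splitm {n : ℕ} {γ : Equiv.Perm ℤ} {R : List (ℤ × List ℤ)} {x z : ℤ} {A1 A2 : List ℤ}
    (h : St n γ ((-1, x :: (A1 ++ z :: A2)) :: R)) :
    ∃ γ', St n γ' ((-1, A1) :: (1, z :: A2) :: R) ∧ Gc n γ x (-z) = Nc n γ' := by
  have hx : x ∈ signedSet n := h.sgn List.mem_cons_self List.mem_cons_self
  have hz : z ∈ signedSet n := h.sgn (z := z) List.mem_cons_self (by simp)
  have hs := h.split (σ := -1) (Or.inr rfl)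
  rw [neg_one_mul, show (-1 : ℤ) * -1 = 1 by norm_num] at hs
  refine ⟨_, hs.remove, Gc_eq h.inb hx (neg_signed.2 hz) (Or.inr ?_)⟩
  have hm : ((1 : ℤ), z :: A2) ∈ ((-1 : ℤ), x :: A1) :: (1, z :: A2) :: R := by simp
  refine drop_rr hx (neg_signed.2 hz) ?_ hs hm ?_
  · intro f hf
    have h3 := (mem_VV.1 hf.1).1 z
    rw [h3, h.fx0 List.mem_cons_self hf z (by simp), h.fx0 List.mem_cons_self hf x (by simp)]
    simp
  · have h1 := h.nd1 List.mem_cons_self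
    rw [eL_neg, eL_one (hs.nd1 hm) List.mem_cons_self hz.1, eL_zero]
    · norm_num
    · intro h2
      simp only [List.map_cons, List.map_append, ← List.cons_append] at h1
      exact (List.disjoint_of_nodup_append h1) (by simp) h2

lemma Gc_flip {n : ℕ} {γ : Equiv.Perm ℤ} {R : List (ℤ × List ℤ)} {x : ℤ} {A : List ℤ}
    (h : St n γ ((-1, x :: A) :: R)) :
    ∃ γ', St n γ' ((1, A) :: R) ∧ Gc n γ x (-x) = Nc n γ' := by
  have hx : x ∈ signedSet n := h.sgn List.mem_cons_self List.mem_cons_self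
  have hs := h.flip
  rw [neg_neg] at hs
  refine ⟨_, hs.remove, Gc_eq h.inb hx (neg_signed.2 hx) (Or.inr ?_)⟩
  refine drop_rr hx (neg_signed.2 hx) ?_ hs List.mem_cons_self ?_
  · intro f hf
    have h3 := (mem_VV.1 hf.1).1 x
    rw [h3, h.fx0 List.mem_cons_self hf x (by simp)]
    simp
  · rw [eL_neg, eL_one (hs.nd1 List.mem_cons_self) List.mem_cons_self hx.1]
    norm_num

lemma Gc_merge {n : ℕ} {γ : Equiv.Perm ℤ} {R : List (ℤ × List ℤ)} {x z σ : ℤ} {A L : List ℤ}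
    (h : St n γ ((-1, x :: A) :: (-1, L) :: R)) (hz : z ∈ L) (hσ : σ = 1 ∨ σ = -1) :
    ∃ γ' L', L'.length = A.length + L.length ∧
      St n γ' ((1, L') :: R) ∧ Gc n γ x (σ * z) = Nc n γ' := by
  have hx : x ∈ signedSet n := h.sgn List.mem_cons_self List.mem_cons_self
  obtain ⟨B1, B2, rfl⟩ := List.append_of_mem hz
  have h2 := ((h.perm (List.Perm.swap _ _ _)).rotate).perm (List.Perm.swap _ _ _)
  have hzs : z ∈ signedSet n := h2.sgn (c := (-1, z :: (B2 ++ B1.map (fun a => -1 * a))))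
    (by simp) (by simp)
  have hy := sgn_signed hσ hzs
  have hs := h2.merge hσ
  rw [show (-1 : ℤ) * -1 = 1 by norm_num] at hs
  refine ⟨_, _, ?_, hs.remove, Gc_eq h.inb hx hy (Or.inr ?_)⟩
  · simp; omega
  refine drop_rr hx hy ?_ hs List.mem_cons_self ?_
  · intro f hf
    have h4 : f z = 0 := h.fx0 (L := B1 ++ z :: B2) (by simp) hf z (by simp)
    have h5 : f (σ * z) = 0 := by
      rcases hσ with rfl | rfl
      · simpa using h4
      · rw [neg_one_mul, (mem_VV.1 hf.1).1 z, h4]; simp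
    rw [h5, h.fx0 List.mem_cons_self hf x (by simp)]
  · have e : σ * z = -(-1 * σ * z) := by ring
    rw [eL_one (hs.nd1 List.mem_cons_self) List.mem_cons_self hx.1, e, eL_neg,
      eL_one (hs.nd1 List.mem_cons_self) (by simp) ?_]
    · norm_num
    · intro h6
      apply hy.1
      rw [e, h6]; simp

lemma St.drop_nil {n : ℕ} {γ : Equiv.Perm ℤ} {R R' : List (ℤ × List ℤ)} {ε : ℤ}
    (h : St n γ (R ++ (ε, []) :: R')) : St n γ (R ++ R') := by
  have hK : K (R ++ (ε, []) :: R') = K (R ++ R') := by simp [K]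
  have hsub : ∀ c ∈ R ++ R', c ∈ R ++ (ε, []) :: R' := by
    intro c hc
    simp only [List.mem_append, List.mem_cons] at *
    tauto
  exact ⟨h.inb, fun c hc => h.sg c (hsub c hc), hK ▸ h.rng, hK ▸ h.nd,
    fun c hc => h.cy c (hsub c hc), fun w hw => h.out w (by rw [hK]; exact hw)⟩

lemma Nc_one (n : ℕ) : Nc n 1 = 1 := by
  have : Sset n 1 = {1} := by
    ext τ
    simp only [Sset, Set.mem_ofPred_eq, Set.mem_singleton_iff]
    constructor
    · rintro ⟨h1, h2⟩
      unfold le' at h2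
      rw [rr_one] at h2
      have h3 : rr n τ = 0 := by omega
      obtain ⟨l, hl, -, h5⟩ := exists_word 0 τ h1 h3
      rw [Nat.le_zero, List.length_eq_zero_iff] at hl
      subst hl
      simpa using h5.symm
    · rintro rfl
      exact ⟨inB_one n, by simp [le', rr_one]⟩
  rw [Nc, this, Set.ncard_singleton]

lemma St_nil {n : ℕ} {γ : Equiv.Perm ℤ} (h : St n γ []) : γ = 1 := by
  ext w
  exact h.out w (by simp [K])

lemma sum_positions (A : List ℤ) (g : ℤ → ℚ) (φ : ℕ → ℕ → ℚ)
    (h : ∀ A1 z A2, A = A1 ++ z :: A2 → g z = φ A1.length A2.length) :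
    (A.map g).sum = ∑ i ∈ Finset.range A.length, φ i (A.length - 1 - i) := by
  induction A generalizing φ with
  | nil => simp
  | cons a A ih =>
    rw [List.map_cons, List.sum_cons, List.length_cons, Finset.sum_range_succ',
      ih (fun i j => φ (i + 1) j), h [] a A rfl, add_comm]
    · congr 1
      apply Finset.sum_congr rfl
      intro i hi
      rw [Finset.mem_range] at hi
      congr 1
      omega
    · intro A1 z A2 e
      simpa using h (a :: A1) z A2 (by simp [e])

lemma sum_pm (l : List ℤ) (hn : (l.map Int.natAbs).Nodup) (h0 : ∀ z ∈ l, z ≠ 0) (g : ℤ → ℚ) :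
    ∑ y ∈ (l ++ l.map (fun a => -a)).toFinset, g y = (l.map (fun z => g z + g (-z))).sum := by
  have hl : l.Nodup := List.Nodup.of_map _ hn
  rw [List.sum_toFinset, List.map_append, List.sum_append, List.map_map, List.sum_map_add]
  · rfl
  · refine List.nodup_append.2 ⟨hl, hl.map neg_injective, ?_⟩
    rintro a ha b hb rfl
    obtain ⟨c, hc, rfl⟩ := List.mem_map.1 hb
    have := List.inj_on_of_nodup_map hn hc ha (by simp)
    have := h0 c hc
    omega
lemma sum_flatten_fin (Ms : List (List ℤ)) (G : ℤ → ℚ) :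
    (Ms.flatten.map G).sum = ∑ j : Fin Ms.length, ((Ms[j]).map G).sum := by
  induction Ms with
  | nil => simp
  | cons L Ms ih =>
    rw [List.flatten_cons, List.map_append, List.sum_append, ih]
    simp only [List.length_cons]
    rw [Fin.sum_univ_succ]
    simp

lemma K_minus (Ms : List (List ℤ)) :
    K (Ms.map (Prod.mk (-1 : ℤ))) = Ms.flatten.map Int.natAbs := by
  simp only [K, List.flatMap_map, List.flatMap_id']

def pts (Ls : List (List ℤ)) : ℕ := (Ls.map List.length).sum

lemma pts_cons (L : List ℤ) (Ls : List (List ℤ)) : pts (L :: Ls) = L.length + pts Ls := by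
  simp [pts]

lemma pts_erase (Ls : List (List ℤ)) (j : ℕ) (hj : j < Ls.length) :
    pts Ls = Ls[j].length + pts (Ls.eraseIdx j) := by
  have := ((List.getElem_cons_eraseIdx_perm hj).map List.length).sum_eq
  simpa [pts] using this.symm

theorem main (n : ℕ) (k : ℕ) : ∀ (Ps Ms : List (List ℤ)) (γ : Equiv.Perm ℤ),
    2 * (pts Ps + pts Ms) + Ps.length + Ms.length < k →
    St n γ (Ps.map (Prod.mk (1 : ℤ)) ++ Ms.map (Prod.mk (-1 : ℤ))) →
    (Nc n γ : ℚ) = DD (Ms.map List.length) * (Ps.map (fun P => Ct P.length)).prod := by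
  induction k with
  | zero => intro _ _ _ h; omega
  | succ k ih =>
  intro Ps Ms γ hk h
  match Ps, Ms with
  | [] :: Ps, Ms =>
    have h' : St n γ (Ps.map (Prod.mk (1 : ℤ)) ++ Ms.map (Prod.mk (-1 : ℤ))) :=
      St.drop_nil (R := []) h
    rw [ih Ps Ms γ (by simp [pts_cons] at hk ⊢; omega) h']
    simp [Ct_zero]
  | [], [] =>
    rw [St_nil h, Nc_one]
    simp [DD_nil]
  | [], [] :: Ms =>
    have h' : St n γ ([].map (Prod.mk (1 : ℤ)) ++ Ms.map (Prod.mk (-1 : ℤ))) :=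
      St.drop_nil (R := []) h
    rw [ih [] Ms γ (by simp [pts_cons] at hk ⊢; omega) h']
    simp [DD_zero]
  | (x :: A) :: Ps, Ms =>
    simp only [List.map_cons, List.cons_append, pts_cons, List.length_cons] at h hk
    have hx : x ∈ signedSet n := h.sgn List.mem_cons_self List.mem_cons_self
    have hnd := h.nd1 List.mem_cons_self
    rw [Nc_sum hx (x :: A).toFinset]
    · push_cast
      rw [List.sum_toFinset _ (List.Nodup.of_map _ hnd), List.map_cons, List.sum_cons]
      rw [sum_positions A (fun y => (Gc n γ x y : ℚ)) (fun i j => DD (Ms.map List.length) *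
        (Ct i * (Ct (j + 1) * (Ps.map (fun P => Ct P.length)).prod)))]
      · obtain ⟨γ', h1, h2⟩ := Gc_self h
        rw [h2, ih (A :: Ps) Ms γ' (by simp [pts_cons]; omega) h1]
        simp only [List.map_cons, List.prod_cons, List.length_cons]
        rw [Ct_succ, Finset.sum_range_succ, Nat.sub_self, Ct_zero, add_mul, mul_add, add_comm,
          mul_one, Finset.sum_mul, Finset.mul_sum]
        congr 1
        apply Finset.sum_congr rfl
        intro i hi
        rw [Finset.mem_range] at hi
        rw [show A.length - 1 - i + 1 = A.length - i by omega]
        ring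
      · rintro A1 z A2 rfl
        obtain ⟨γ', h1, h2⟩ := Gc_splitp h
        rw [h2, ih (A1 :: (z :: A2) :: Ps) Ms γ' (by simp [pts_cons] at hk ⊢; omega) h1]
        simp
    · intro y hy hyU
      have hm : y ∉ x :: A := by simpa using hyU
      refine Gc_zero (h.eLFx List.mem_cons_self) ?_
      rw [eL_one hnd List.mem_cons_self hx.1]
      simp only [eL, if_neg hm]
      split_ifs <;> norm_num
  | [], (x :: A) :: Ms =>
    simp only [List.map_cons, List.map_nil, List.nil_append, pts_cons, List.length_cons] at h hk
    have hx : x ∈ signedSet n := h.sgn List.mem_cons_self List.mem_cons_self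
    have hK : K ((-1, x :: A) :: Ms.map (Prod.mk (-1 : ℤ))) =
      ((x :: A) ++ Ms.flatten).map Int.natAbs := by
      rw [K_cons, K_minus, List.map_append]
    have hnd := h.nd
    rw [hK] at hnd
    rw [Nc_sum hx (((x :: A) ++ Ms.flatten) ++ ((x :: A) ++ Ms.flatten).map (fun a => -a)).toFinset]
    · push_cast
      rw [sum_pm _ hnd]
      · rw [List.map_append, List.sum_append, List.map_cons, List.sum_cons, sum_flatten_fin,
          List.map_cons, List.length_cons, DD_rec]
        set l := Ms.map List.length with hl
        rw [sum_positions A (fun z => (Gc n γ x z : ℚ) + (Gc n γ x (-z) : ℚ))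
          (fun i j => Ct i * DD ((j + 1) :: l) + DD (i :: l) * Ct (j + 1))]
        · simp only [List.map_nil, List.prod_nil, mul_one]
          congr 1
          · obtain ⟨γ', h1, h2⟩ := Gc_self h
            obtain ⟨γ'', h3, h4⟩ := Gc_flip h
            rw [h2, h4, ih [] (A :: Ms) γ' (by simp [pts_cons, pts] at hk ⊢; omega) h1,
              ih [A] Ms γ'' (by simp [pts_cons, pts] at hk ⊢; omega) h3]
            simp only [List.map_nil, List.prod_nil, mul_one, List.map_cons, List.prod_cons, ← hl]
            rw [Finset.sum_add_distrib, two_mul]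
            have e1 : ∑ i ∈ Finset.range (A.length + 1), Ct (A.length - i) * DD (i :: l) =
              ∑ i ∈ Finset.range A.length, Ct i * DD ((A.length - 1 - i + 1) :: l) +
                Ct A.length * DD l := by
              rw [← Finset.sum_range_reflect, Finset.sum_range_succ]
              congr 1
              · apply Finset.sum_congr rfl
                intro i hi
                rw [Finset.mem_range] at hi
                rw [show A.length - (A.length + 1 - 1 - i) = i by omega,
                  show A.length + 1 - 1 - i = A.length - 1 - i + 1 by omega]
              · simp [DD_zero]
            have e2 : ∑ i ∈ Finset.range (A.length + 1), Ct (A.length - i) * DD (i :: l) =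
              ∑ i ∈ Finset.range A.length, DD (i :: l) * Ct (A.length - 1 - i + 1) +
                DD (A.length :: l) := by
              rw [Finset.sum_range_succ, Nat.sub_self, Ct_zero, one_mul]
              congr 1
              apply Finset.sum_congr rfl
              intro i hi
              rw [Finset.mem_range] at hi
              rw [show A.length - 1 - i + 1 = A.length - i by omega, mul_comm]
            nth_rewrite 1 [e1]
            rw [e2]
            ring
          · refine Fintype.sum_equiv (finCongr (by simp [hl])) _ _ ?_
            intro j
            have hp : (Ms[j] :: Ms.eraseIdx j).Perm Ms := List.getElem_cons_eraseIdx_perm j.2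
            have h' := h.perm (((hp.map (Prod.mk (-1 : ℤ))).symm).cons _)
            simp only [List.map_cons] at h'
            have hpt := pts_erase Ms j j.2
            have hlen : (Ms.eraseIdx j).length + 1 = Ms.length := by
              have := hp.length_eq
              simpa using this
            have key : ∀ z ∈ Ms[j], ∀ σ : ℤ, (σ = 1 ∨ σ = -1) → (Gc n γ x (σ * z) : ℚ) =
                Ct (A.length + Ms[j].length) * DD ((Ms.eraseIdx j).map List.length) := by
              intro z hz σ hσ
              obtain ⟨γ', L', h1, h2, h3⟩ := Gc_merge h' hz hσ
              rw [h3, ih [L'] (Ms.eraseIdx j) γ' ?_ h2]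
              · simp [h1, mul_comm]
              · simp only [pts_cons, List.length_cons, List.length_nil]
                simp only [Fin.getElem_fin] at h1
                simp [pts] at hpt hk ⊢
                omega
            have key2 : (Ms[j]).map (fun z => (Gc n γ x z : ℚ) + (Gc n γ x (-z) : ℚ)) =
                (Ms[j]).map (fun _ => 2 *
                  (Ct (A.length + Ms[j].length) * DD ((Ms.eraseIdx j).map List.length))) := by
              apply List.map_congr_left
              intro z hz
              have a1 := key z hz 1 (Or.inl rfl)
              have a2 := key z hz (-1) (Or.inr rfl)
              rw [one_mul] at a1
              rw [neg_one_mul] at a2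
              rw [a1, a2]; ring
            rw [key2, List.map_const', List.sum_replicate]
            simp [hl, List.eraseIdx_map]
            ring
        · rintro A1 z A2 rfl
          obtain ⟨γ', h1, h2⟩ := Gc_splitp h
          obtain ⟨γ'', h3, h4⟩ := Gc_splitm h
          rw [h2, h4, ih [A1] ((z :: A2) :: Ms) γ' (by simp [pts_cons, pts] at hk ⊢; omega) h1,
            ih [z :: A2] (A1 :: Ms) γ'' (by simp [pts_cons, pts] at hk ⊢; omega)
              (h3.perm (List.Perm.swap _ _ _))]
          simp [← hl, mul_comm]
      · intro z hz
        have : z.natAbs ∈ K ((-1, x :: A) :: Ms.map (Prod.mk (-1 : ℤ))) := by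
          rw [hK]; exact List.mem_map_of_mem hz
        have := (h.rng _ this).1
        omega
    · intro y hy hyU
      have hy2 : y.natAbs ∉ K ((-1, x :: A) :: Ms.map (Prod.mk (-1 : ℤ))) := by
        rw [hK]
        intro h1
        obtain ⟨c, hc, h2⟩ := List.mem_map.1 h1
        apply hyU
        rw [List.mem_toFinset, List.mem_append]
        rcases Int.natAbs_eq_natAbs_iff.1 h2 with rfl | rfl
        · exact Or.inl hc
        · refine Or.inr (List.mem_map.2 ⟨_, hc, by simp⟩)
      have hfix := h.out y hy2
      have hf : eL [y] ∈ Fx n γ := by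
        refine eL_Fx h.inb (by simpa using hy) ?_
        intro w
        simp only [List.mem_singleton]
        constructor
        · intro h1; exact γ.injective (by rw [h1, hfix])
        · rintro rfl; exact hfix
      refine Gc_zero hf ?_
      rw [eL_one (x := y) (by simp) (by simp) hy.1, eL_zero]
      · norm_num
      · intro h1
        apply hy2
        rw [hK]
        simp at h1
        simp [h1]
lemma path_range (γ : Equiv.Perm ℤ) (x : ℤ) (q a : ℕ) :
    path γ ((γ ^ a) x) ((List.range' (a + 1) q).map (fun i => (γ ^ i) x)) ((γ ^ (a + q + 1)) x) := by
  induction q generalizing a with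
  | zero => simp [path, pow_succ']
  | succ q ih =>
    rw [List.range'_succ, List.map_cons]
    refine ⟨by simp [pow_succ'], ?_⟩
    have := ih (a + 1)
    rwa [show a + 1 + q + 1 = a + (q + 1) + 1 by ring] at this

lemma pow_neg' {n : ℕ} {γ : Equiv.Perm ℤ} (hγ : inB n γ) (i : ℕ) (x : ℤ) :
    (γ ^ i) (-x) = -(γ ^ i) x := by
  induction i with
  | zero => simp
  | succ i ih => rw [pow_succ', Equiv.Perm.mul_apply, ih, hγ.1, Equiv.Perm.mul_apply]

lemma orbit_eq {γ : Equiv.Perm ℤ} {x y : ℤ} (h : y ∈ permOrbit γ x) :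
    permOrbit γ y = permOrbit γ x := by
  obtain ⟨m, rfl⟩ := h
  ext w
  constructor
  · rintro ⟨k, rfl⟩
    exact ⟨k + m, by rw [zpow_add, Equiv.Perm.mul_apply]⟩
  · rintro ⟨k, rfl⟩
    exact ⟨k - m, by rw [← Equiv.Perm.mul_apply, ← zpow_add, sub_add_cancel]⟩

lemma orbit_list {n m : ℕ} {γ : Equiv.Perm ℤ} (hγ : inB n γ) {x : ℤ} (hx : x ∈ signedSet n)
    (hinv : negSet (permOrbit γ x) = permOrbit γ x) (hc : (permOrbit γ x).ncard = 2 * m)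
    (hm : 1 ≤ m) :
    ∃ M : List ℤ, M.length = m ∧ cyc γ (-1) M ∧ (M.map Int.natAbs).Nodup ∧
      (∀ z ∈ M, z ∈ permOrbit γ x) ∧ ∀ w ∈ permOrbit γ x, w.natAbs ∈ M.map Int.natAbs := by
  have hfin : (permOrbit γ x).Finite := Set.finite_of_ncard_pos (by omega)
  have hpm : ∀ i : ℕ, (γ ^ i) x ∈ permOrbit γ x := fun i => ⟨i, by simp⟩
  have hx0 : x ≠ 0 := hx.1
  obtain ⟨a, b, hab, hab2⟩ : ∃ a b : ℕ, a < b ∧ (γ ^ a) x = (γ ^ b) x := by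
    have := hfin.to_subtype
    obtain ⟨a, b, hne, he⟩ := Finite.exists_ne_map_eq_of_infinite
      (fun i : ℕ => (⟨(γ ^ i) x, hpm i⟩ : permOrbit γ x))
    have he' : (γ ^ a) x = (γ ^ b) x := congrArg Subtype.val he
    rcases lt_or_gt_of_ne hne with h | h
    · exact ⟨a, b, h, he'⟩
    · exact ⟨b, a, h, he'.symm⟩
  have hd : (γ ^ (b - a)) x = x := by
    apply (γ ^ a).injective
    rw [← Equiv.Perm.mul_apply, ← pow_add, hab2]
    congr 2; omega
  have hneg : -x ∈ permOrbit γ x := by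
    have : x ∈ negSet (permOrbit γ x) := by rw [hinv]; exact hpm 0
    exact this
  have hex : ∃ p : ℕ, 0 < p ∧ (γ ^ p) x = -x := by
    obtain ⟨j, hj⟩ := hneg
    have hdp : (1 : ℤ) ≤ ((b - a : ℕ) : ℤ) := by omega
    have hpos : 0 < j + ((b - a : ℕ) : ℤ) * (|j| + 1) := by
      have := neg_abs_le j
      have h0 := abs_nonneg j
      nlinarith
    refine ⟨(j + ((b - a : ℕ) : ℤ) * (|j| + 1)).toNat, by omega, ?_⟩
    rw [← zpow_natCast, Int.toNat_of_nonneg hpos.le, zpow_add, Equiv.Perm.mul_apply, zpow_mul,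
      zpow_natCast, Equiv.Perm.zpow_apply_eq_self_of_apply_eq_self hd, hj]
  classical
  obtain ⟨hp0, hp1⟩ := Nat.find_spec hex
  have hmin := fun q => @Nat.find_min _ _ hex q
  set p := Nat.find hex with hpdef
  have hne1 : ∀ d, 0 < d → d < p → (γ ^ d) x ≠ -x := fun d h0 h1 h2 => hmin d h1 ⟨h0, h2⟩
  have hne2 : ∀ d, 0 < d → d < p → (γ ^ d) x ≠ x := by
    intro d h0 h1 h2
    refine hne1 (p - d) (by omega) (by omega) ?_
    rw [← hp1]
    nth_rewrite 1 [← h2]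
    rw [← Equiv.Perm.mul_apply, ← pow_add]
    congr 2; omega
  have hinj : ∀ i j, i < j → j < p → ((γ ^ i) x).natAbs ≠ ((γ ^ j) x).natAbs := by
    intro i j hij hjp h
    have e : (γ ^ j) x = (γ ^ i) ((γ ^ (j - i)) x) := by
      rw [← Equiv.Perm.mul_apply, ← pow_add]
      congr 2; omega
    rcases Int.natAbs_eq_natAbs_iff.1 h with h | h
    · rw [e] at h
      exact hne2 (j - i) (by omega) (by omega) ((γ ^ i).injective h).symm
    · rw [e, ← pow_neg' hγ] at h
      have := (γ ^ i).injective h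
      exact hne1 (j - i) (by omega) (by omega) (by omega)
  have h2p : (γ ^ (2 * p)) x = x := by
    rw [two_mul, pow_add, Equiv.Perm.mul_apply, hp1, pow_neg' hγ, hp1, neg_neg]
  have hcov : ∀ w ∈ permOrbit γ x, ∃ i < p, w = (γ ^ i) x ∨ w = -(γ ^ i) x := by
    rintro w ⟨k, rfl⟩
    have hpp : (0 : ℤ) < ((2 * p : ℕ) : ℤ) := by omega
    have e : (γ ^ k) x = (γ ^ (k % ((2 * p : ℕ) : ℤ)).toNat) x := by
      have h0 := Int.emod_nonneg k hpp.ne'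
      conv_lhs => rw [← Int.emod_add_mul_ediv k ((2 * p : ℕ) : ℤ)]
      rw [zpow_add, Equiv.Perm.mul_apply, zpow_mul, zpow_natCast,
        Equiv.Perm.zpow_apply_eq_self_of_apply_eq_self h2p, ← zpow_natCast, Int.toNat_of_nonneg h0]
    have hlt := Int.emod_lt_of_pos k hpp
    rw [e]
    generalize hr : (k % ((2 * p : ℕ) : ℤ)).toNat = r
    have hr2 : r < 2 * p := by omega
    by_cases h : r < p
    · exact ⟨r, h, Or.inl rfl⟩
    · refine ⟨r - p, by omega, Or.inr ?_⟩
      rw [← pow_neg' hγ, ← hp1, ← Equiv.Perm.mul_apply, ← pow_add]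
      congr 2; omega
  have hnd : ((List.range' 0 p).map (fun i => ((γ ^ i) x).natAbs)).Nodup := by
    refine List.Nodup.map_on ?_ List.nodup_range'
    intro i hi j hj h
    simp only [List.mem_range'_1, zero_add] at hi hj
    rcases lt_trichotomy i j with h' | h' | h'
    · exact absurd h (hinj i j h' hj.2)
    · exact h'
    · exact absurd h.symm (hinj j i h' hi.2)
  set M := (List.range' 0 p).map (fun i => (γ ^ i) x) with hM
  have hnd' : (M.map Int.natAbs).Nodup := by
    rw [hM, List.map_map]; exact hnd
  have hMmem : ∀ z ∈ M, z ∈ permOrbit γ x := by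
    intro z hz
    obtain ⟨i, -, rfl⟩ := List.mem_map.1 hz
    exact hpm i
  have hMi : ∀ i < p, (γ ^ i) x ∈ M := fun i hi => List.mem_map.2 ⟨i, by simp [hi], rfl⟩
  have hM0 : ∀ z ∈ M, z ≠ 0 := by
    intro z hz
    obtain ⟨i, -, rfl⟩ := List.mem_map.1 hz
    intro h
    have h2 : (γ ^ i) 0 = 0 := by
      have := pow_neg' hγ i 0
      rw [neg_zero] at this
      omega
    exact hx0 ((γ ^ i).injective (h.trans h2.symm))
  have hset : permOrbit γ x = ((M ++ M.map (fun a => -a)).toFinset : Set ℤ) := by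
    ext w
    simp only [List.coe_toFinset, Set.mem_ofPred_eq, List.mem_append, List.mem_map]
    constructor
    · intro hw
      obtain ⟨i, hi, rfl | rfl⟩ := hcov w hw
      · exact Or.inl (hMi i hi)
      · exact Or.inr ⟨_, hMi i hi, rfl⟩
    · rintro (hw | ⟨z, hz, rfl⟩)
      · exact hMmem w hw
      · have : z ∈ negSet (permOrbit γ x) := by rw [hinv]; exact hMmem z hz
        exact this
  have hlen : M.length = p := by simp [hM]
  have hpm' : p = m := by
    have e1 := sum_pm M hnd' hM0 (fun _ => 1)
    rw [hset, Set.ncard_coe_finset] at hc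
    rw [Finset.sum_const, hc] at e1
    simp [hlen] at e1
    have e2 : (m : ℚ) = p := by linarith
    exact_mod_cast e2.symm
  refine ⟨M, by rw [hlen, hpm'], ?_, hnd', hMmem, ?_⟩
  · obtain ⟨q, hq⟩ : ∃ q, p = q + 1 := ⟨p - 1, by omega⟩
    rw [hM, hq, List.range'_succ, List.map_cons]
    have := path_range γ x q 0
    rw [zero_add, zero_add, ← hq, hp1] at this
    simpa [cyc] using this
  · intro w hw
    obtain ⟨i, hi, rfl | rfl⟩ := hcov w hw
    · exact List.mem_map_of_mem (hMi i hi)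
    · rw [Int.natAbs_neg]; exact List.mem_map_of_mem (hMi i hi)

lemma orbits_disj {γ : Equiv.Perm ℤ} {x y : ℤ} {M M' : List ℤ}
    (hinv : negSet (permOrbit γ x) = permOrbit γ x) (hne : permOrbit γ x ≠ permOrbit γ y)
    (h1 : ∀ z ∈ M, z ∈ permOrbit γ x) (h2 : ∀ z ∈ M', z ∈ permOrbit γ y) :
    ∀ k ∈ M.map Int.natAbs, ∀ k' ∈ M'.map Int.natAbs, k ≠ k' := by
  intro k hk k' hk' he
  obtain ⟨z, hz, rfl⟩ := List.mem_map.1 hk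
  obtain ⟨w, hw, rfl⟩ := List.mem_map.1 hk'
  have hzx := h1 z hz
  have hwy := h2 w hw
  have : w ∈ permOrbit γ x := by
    rcases Int.natAbs_eq_natAbs_iff.1 he with h | h
    · rw [← h]; exact hzx
    · rw [← hinv]
      change -w ∈ permOrbit γ x
      rw [← h]; exact hzx
  exact hne ((orbit_eq this).symm.trans (orbit_eq hwy))

theorem final (n1 n2 n3 : ℕ) (h1 : 1 ≤ n1) (h2 : 1 ≤ n2) (h3 : 1 ≤ n3)
    (γ : Equiv.Perm ℤ) (hγ : inB (n1 + n2 + n3) γ)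
    (A1 A2 A3 : Set ℤ)
    (h12 : A1 ≠ A2) (h13 : A1 ≠ A3) (h23 : A2 ≠ A3)
    (horb : orbitsOn (n1 + n2 + n3) γ = {A1, A2, A3})
    (hinv1 : negSet A1 = A1) (hinv2 : negSet A2 = A2) (hinv3 : negSet A3 = A3)
    (hcard1 : A1.ncard = 2 * n1) (hcard2 : A2.ncard = 2 * n2) (hcard3 : A3.ncard = 2 * n3) :
    (Nc (n1 + n2 + n3) γ : ℚ) = DD [n1, n2, n3] := by
  have m1 : A1 ∈ orbitsOn (n1 + n2 + n3) γ := by rw [horb]; simp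
  have m2 : A2 ∈ orbitsOn (n1 + n2 + n3) γ := by rw [horb]; simp
  have m3 : A3 ∈ orbitsOn (n1 + n2 + n3) γ := by rw [horb]; simp
  obtain ⟨x1, hx1, rfl⟩ := m1
  obtain ⟨x2, hx2, rfl⟩ := m2
  obtain ⟨x3, hx3, rfl⟩ := m3
  obtain ⟨M1, l1, c1, d1, s1, v1⟩ := orbit_list hγ hx1 hinv1 hcard1 h1
  obtain ⟨M2, l2, c2, d2, s2, v2⟩ := orbit_list hγ hx2 hinv2 hcard2 h2
  obtain ⟨M3, l3, c3, d3, s3, v3⟩ := orbit_list hγ hx3 hinv3 hcard3 h3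
  have hsg : ∀ x ∈ signedSet (n1 + n2 + n3), ∀ z ∈ permOrbit γ x, z ∈ signedSet (n1 + n2 + n3) := by
    rintro x hx z hz
    by_contra h
    have hf : γ z = z := hγ.2 z h
    have : x ∈ permOrbit γ z := by rw [orbit_eq hz]; exact ⟨0, by simp⟩
    obtain ⟨k, hk⟩ := this
    rw [Equiv.Perm.zpow_apply_eq_self_of_apply_eq_self hf] at hk
    exact h (hk ▸ hx)
  have hK : K [((-1 : ℤ), M1), (-1, M2), (-1, M3)] =
      M1.map Int.natAbs ++ (M2.map Int.natAbs ++ M3.map Int.natAbs) := by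
    simp [K]
  have hS : St (n1 + n2 + n3) γ [((-1 : ℤ), M1), (-1, M2), (-1, M3)] := by
    refine ⟨hγ, ?_, ?_, ?_, ?_, ?_⟩
    · simp
    · rw [hK]
      intro k hk
      have aux : ∀ x ∈ signedSet (n1 + n2 + n3), ∀ M : List ℤ, (∀ z ∈ M, z ∈ permOrbit γ x) →
          k ∈ M.map Int.natAbs → 1 ≤ k ∧ k ≤ n1 + n2 + n3 := by
        intro x hx M hM hk
        obtain ⟨z, hz, rfl⟩ := List.mem_map.1 hk
        exact signed_natAbs.1 (hsg x hx z (hM z hz))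
      rcases List.mem_append.1 hk with hk | hk
      · exact aux x1 hx1 M1 s1 hk
      rcases List.mem_append.1 hk with hk | hk
      · exact aux x2 hx2 M2 s2 hk
      · exact aux x3 hx3 M3 s3 hk
    · rw [hK]
      refine List.nodup_append.2 ⟨d1, List.nodup_append.2
        ⟨d2, d3, orbits_disj hinv2 h23 s2 s3⟩, ?_⟩
      intro k hk k' hk'
      rcases List.mem_append.1 hk' with hk' | hk'
      · exact orbits_disj hinv1 h12 s1 s2 k hk k' hk'
      · exact orbits_disj hinv1 h13 s1 s3 k hk k' hk'
    · intro c hc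
      simp only [List.mem_cons, List.not_mem_nil, or_false] at hc
      rcases hc with rfl | rfl | rfl
      · exact c1
      · exact c2
      · exact c3
    · intro w hw
      by_cases hws : w ∈ signedSet (n1 + n2 + n3)
      · exfalso
        apply hw
        rw [hK]
        have hself : w ∈ permOrbit γ w := ⟨0, by simp⟩
        have : permOrbit γ w ∈ orbitsOn (n1 + n2 + n3) γ := ⟨w, hws, rfl⟩
        rw [horb] at this
        simp only [Set.mem_insert_iff, Set.mem_singleton_iff] at this
        rw [List.mem_append, List.mem_append]
        rcases this with h | h | h
        · exact Or.inl (v1 w (h ▸ hself))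
        · exact Or.inr (Or.inl (v2 w (h ▸ hself)))
        · exact Or.inr (Or.inr (v3 w (h ▸ hself)))
      · exact hγ.2 w hws
  have := main (n1 + n2 + n3) _ [] [M1, M2, M3] γ (Nat.lt_succ_self _) hS
  rw [this]
  simp [l1, l2, l3]

end NCBaux

/-- If `γ ∈ B_n` (`n = n₁+n₂+n₃`) has exactly 3 orbits, all
inversion-invariant, of sizes `2n₁, 2n₂, 2n₃`, then
`|NC^B(n₁,n₂,n₃)| = (1 + n₁n₂/(n₁+n₂) + n₁n₃/(n₁+n₃) + n₂n₃/(n₂+n₃))·C(2n₁,n₁)C(2n₂,n₂)C(2n₃,n₃)`. -/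
theorem ncb_three_annuli_card (n1 n2 n3 : ℕ) (h1 : 1 ≤ n1) (h2 : 1 ≤ n2) (h3 : 1 ≤ n3)
    (γ : Equiv.Perm ℤ) (hγ : inB (n1 + n2 + n3) γ)
    (A1 A2 A3 : Set ℤ)
    (h12 : A1 ≠ A2) (h13 : A1 ≠ A3) (h23 : A2 ≠ A3)
    (horb : orbitsOn (n1 + n2 + n3) γ = {A1, A2, A3})
    (hinv1 : negSet A1 = A1) (hinv2 : negSet A2 = A2) (hinv3 : negSet A3 = A3)
    (hcard1 : A1.ncard = 2 * n1) (hcard2 : A2.ncard = 2 * n2) (hcard3 : A3.ncard = 2 * n3) :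
    ({π | ∃ τ, inB (n1 + n2 + n3) τ ∧ leB (n1 + n2 + n3) τ γ ∧
        π = omegaTilde (n1 + n2 + n3) τ}.ncard : ℚ) =
      (1 + ((n1 : ℚ) * n2) / ((n1 : ℚ) + n2) + ((n1 : ℚ) * n3) / ((n1 : ℚ) + n3) +
          ((n2 : ℚ) * n3) / ((n2 : ℚ) + n3)) *
        (Nat.choose (2 * n1) n1 : ℚ) * (Nat.choose (2 * n2) n2 : ℚ) *
        (Nat.choose (2 * n3) n3 : ℚ) := by
  rw [NCBaux.card_omega hγ, NCBaux.final n1 n2 n3 h1 h2 h3 γ hγ A1 A2 A3 h12 h13 h23 horb hinv1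
    hinv2 hinv3 hcard1 hcard2 hcard3]
  exact NCBaux.DD_three n1 n2 n3 h1 h2 h3
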